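/- arXiv:1602.08669 — 13 statements merged into one kernel-verified Lean document; each statement's English description precedes it below -/
import Mathlib

section
/- For a finite bipartite graph G, the following are equivalent: (1) G is a unit interval bigraph; (2) G is a proper interval bigraph; (3) G is a class-proper interval 2-graph; (4) G is a permutation graph; (5) G admits a proper 2-coloring c and an enumeration v_1, …, v_n of its vertices such that whenever v_i v_k is an edge and i < j < k, the vertex v_j is adjacent to whichever of v_i, v_k has a color different from c(v_j). -/
/-- `(L, R, c)` is an interval `k`-representation of the simple graph `G`:
`L v ≤ R v` for every vertex, and two distinct vertices are adjacent iff they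
receive different colors and their closed intervals intersect. -/
def IsIntervalKRep {V : Type*} (G : SimpleGraph V) (k : ℕ)
    (L R : V → ℝ) (c : V → Fin k) : Prop :=
  (∀ v, L v ≤ R v) ∧
  ∀ u v : V, u ≠ v →
    (G.Adj u v ↔ c u ≠ c v ∧
      (Set.Icc (L u) (R u) ∩ Set.Icc (L v) (R v)).Nonempty)

/-- A representation is class-proper: no interval properly contains another
interval of the same color class. -/
def ClassProperRep {V : Type*} {k : ℕ} (L R : V → ℝ) (c : V → Fin k) : Prop :=
  ∀ u v : V, u ≠ v → c u = c v →
    ¬ (Set.Icc (L u) (R u) ⊂ Set.Icc (L v) (R v))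

/-- A representation is proper: no interval properly contains another. -/
def ProperRep {V : Type*} (L R : V → ℝ) : Prop :=
  ∀ u v : V, u ≠ v → ¬ (Set.Icc (L u) (R u) ⊂ Set.Icc (L v) (R v))

/-- A representation is unit: all intervals have the same length. -/
def UnitRep {V : Type*} (L R : V → ℝ) : Prop :=
  ∀ u v : V, R u - L u = R v - L v
/-- `G` is a permutation graph: there are injective placements `p`, `q` of the
vertices on two parallel channels such that distinct vertices are adjacent iff
their segments cross. -/
def IsPermutationGraph {V : Type*} (G : SimpleGraph V) : Prop :=
  ∃ p q : V → ℝ, Function.Injective p ∧ Function.Injective q ∧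
    ∀ u v : V, u ≠ v → (G.Adj u v ↔ ((p u < p v) ↔ (q v < q u)))
/-- `G` admits a proper 2-coloring `c` and an enumeration `v_1, …, v_n` of its
vertices such that whenever `v_i v_k` is an edge and `i < j < k`, the vertex
`v_j` is adjacent to whichever of `v_i, v_k` has a color different from
`c (v_j)`. -/
def GoodOrdering {V : Type*} [Fintype V] (G : SimpleGraph V) : Prop :=
  ∃ (c : V → Fin 2) (e : Fin (Fintype.card V) ≃ V),
    (∀ u v : V, G.Adj u v → c u ≠ c v) ∧
    ∀ i j k : Fin (Fintype.card V), i < j → j < k → G.Adj (e i) (e k) →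
      (c (e i) ≠ c (e j) → G.Adj (e j) (e i)) ∧
      (c (e k) ≠ c (e j) → G.Adj (e j) (e k))

/-- For each color class, ordering its vertices by `s` makes `s` a strong ordering of the bipartite
graph `G`: crossing edges `x y'` and `x' y` force the edges `x y` and `x' y'`. -/
structure IsStrongOrdering {V : Type*} (G : SimpleGraph V) (c : V → Fin 2) (s : V → ℕ) : Prop where
  injective : Function.Injective s
  color_ne : ∀ u v, G.Adj u v → c u ≠ c v
  cross : ∀ x x' y y', c x = c x' → s x < s x' → s y < s y' → G.Adj x y' → G.Adj x' y →
    G.Adj x y ∧ G.Adj x' y'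

/-- The number of strict `s`-descents made by iterating `T` from `v`, plus the value of `s` at the
point where the descent stops. -/
def descentRank {V : Type*} (T : V → V) (s : V → ℕ) (v : V) : ℕ :=
  if s (T v) < s v then descentRank T s (T v) + 1 else s v
termination_by s v

theorem descentRank_of_lt {V : Type*} {T : V → V} {s : V → ℕ} {v : V} (h : s (T v) < s v) :
    descentRank T s v = descentRank T s (T v) + 1 := by
  rw [descentRank, if_pos h]

theorem descentRank_of_not_lt {V : Type*} {T : V → V} {s : V → ℕ} {v : V} (h : ¬ s (T v) < s v) :
    descentRank T s v = s v := by
  rw [descentRank, if_neg h]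

theorem descentRank_le {V : Type*} (T : V → V) (s : V → ℕ) (v : V) : descentRank T s v ≤ s v := by
  induction hn : s v using Nat.strong_induction_on generalizing v with
  | _ n ih =>
    by_cases h : s (T v) < s v
    · rw [descentRank_of_lt h]
      have := ih _ (hn ▸ h) (T v) rfl
      omega
    · rw [descentRank_of_not_lt h, hn]

section DescentRank

variable {V : Type*} {T : V → V} {s : V → ℕ} {S : Set V}

theorem descentRank_mono (hS : ∀ v ∈ S, T v ∈ S)
    (hT : ∀ u ∈ S, ∀ v ∈ S, s u ≤ s v → s (T u) ≤ s (T v)) {u v : V} (hu : u ∈ S) (hv : v ∈ S)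
    (huv : s u ≤ s v) : descentRank T s u ≤ descentRank T s v := by
  induction hn : s v using Nat.strong_induction_on generalizing u v with
  | _ n ih =>
    have hTuv := hT u hu v hv huv
    by_cases h : s (T v) < s v
    · rw [descentRank_of_lt h]
      by_cases h' : s (T u) < s u
      · rw [descentRank_of_lt h']
        have := ih _ (hn ▸ h) (hS u hu) (hS v hv) hTuv rfl
        omega
      · have := ih _ (hn ▸ h) hu (hS v hv) (by omega) rfl
        omega
    · rw [descentRank_of_not_lt h]
      exact (descentRank_le T s u).trans huv

theorem eq_of_descentRank_eq (hs : Function.Injective s) (hS : ∀ v ∈ S, T v ∈ S)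
    (hT : ∀ u ∈ S, ∀ v ∈ S, s u ≤ s v → s (T u) ≤ s (T v)) {u v : V} (hu : u ∈ S) (hv : v ∈ S)
    (hroot : ¬ s (T v) < s v) (huv : descentRank T s u = descentRank T s v) : u = v := by
  have hle := descentRank_le T s u
  have hv' := descentRank_of_not_lt hroot
  rcases lt_trichotomy (s u) (s v) with h | h | h
  · omega
  · exact hs h
  · by_cases h' : s (T u) < s u
    · have h1 := descentRank_of_lt h'
      have h2 := descentRank_mono hS hT hv (hS u hu) (by have := hT v hv u hu h.le; omega)
      omega
    · have h1 := descentRank_of_not_lt h'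
      omega

end DescentRank

namespace IsStrongOrdering

variable {V : Type*} {G : SimpleGraph V} {c : V → Fin 2} {s : V → ℕ}

/-- Neighborhoods are convex among the non-isolated vertices. -/
theorem adj_of_between (h : IsStrongOrdering G c s) {a b d y z : V} (hab : c a = c b)
    (hbd : c b = c d) (hsab : s a ≤ s b) (hsbd : s b ≤ s d) (ha : G.Adj a y) (hd : G.Adj d y)
    (hb : G.Adj b z) : G.Adj b y := by
  rcases hsab.eq_or_lt with e | hsab
  · rwa [← h.injective e]
  rcases hsbd.eq_or_lt with e | hsbd
  · rwa [h.injective e]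
  rcases lt_trichotomy (s y) (s z) with hyz | hyz | hyz
  · exact (h.cross b d y z hbd hsbd hyz hb hd).1
  · rwa [h.injective hyz]
  · exact (h.cross a b z y hab hsab hyz ha hb).2

theorem minNeighbor_mono (h : IsStrongOrdering G c s) {m : V → V}
    (hm : ∀ v w, G.Adj v w → G.Adj v (m v) ∧ s (m v) ≤ s w) {u v u' v' : V} (hc : c u = c v)
    (hu : G.Adj u u') (hv : G.Adj v v') (huv : s u ≤ s v) : s (m u) ≤ s (m v) := by
  rcases huv.eq_or_lt with e | huv
  · rw [h.injective e]
  by_contra! hlt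
  have := (h.cross u v (m v) (m u) hc huv hlt (hm u u' hu).1 (hm v v' hv).1).1
  have := (hm u _ this).2
  omega

/-- Breadth-first layers of the non-isolated vertices. -/
theorem exists_layering (h : IsStrongOrdering G c s) {m : V → V}
    (hm : ∀ v w, G.Adj v w → G.Adj v (m v) ∧ s (m v) ≤ s w) :
    ∃ κ : V → ℕ, (∀ v, κ v % 2 = c v) ∧
      (∀ u v u' v', G.Adj u u' → G.Adj v v' → c u = c v → s u ≤ s v → κ u ≤ κ v) ∧
      (∀ u v, G.Adj u v → κ u ≤ κ v + 1) ∧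
      ∀ v v', G.Adj v v' → κ v = κ (m v) + 1 ∨
        ∀ w w', G.Adj w w' → κ w = κ v + 1 → m w = v := by
  set g := descentRank (fun v => m (m v)) s with hg
  set κ : V → ℕ := fun v => if c v = 0 then 2 * g v else 2 * g (m v) + 1 with hκ
  have κ0 : ∀ v, c v = 0 → κ v = 2 * g v := fun v hv => by simp [hκ, hv]
  have κ1 : ∀ v, c v ≠ 0 → κ v = 2 * g (m v) + 1 := fun v hv => by simp [hκ, hv]
  set S : Set V := {v | c v = 0 ∧ ∃ w, G.Adj v w} with hSdef
  have hflip : ∀ u v, G.Adj u v → (c v = 0 ↔ c u ≠ 0) := by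
    intro u v huv
    have := h.color_ne u v huv
    omega
  have hmS : ∀ v w, G.Adj v w → c v ≠ 0 → m v ∈ S := fun v w hvw hv =>
    ⟨(hflip _ _ (hm v w hvw).1).2 hv, v, (hm v w hvw).1.symm⟩
  have hmono := fun {u v u' v' : V} => h.minNeighbor_mono hm (u := u) (v := v) (u' := u') (v' := v')
  have hS : ∀ v ∈ S, m (m v) ∈ S := by
    rintro v ⟨hv, w, hw⟩
    refine hmS (m v) v (hm v w hw).1.symm fun h0 => ?_
    exact (hflip _ _ (hm v w hw).1).1 h0 hv
  have hm1 : ∀ v ∈ S, c (m v) ≠ 0 := by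
    rintro v ⟨hv, w, hw⟩ h0
    exact (hflip _ _ (hm v w hw).1).1 h0 hv
  have hT : ∀ u ∈ S, ∀ v ∈ S, s u ≤ s v → s (m (m u)) ≤ s (m (m v)) := by
    intro u hu v hv huv
    have h1 := hm1 u hu
    have h2 := hm1 v hv
    obtain ⟨hu, u', hu'⟩ := hu
    obtain ⟨hv, v', hv'⟩ := hv
    exact hmono (by omega) (hm u u' hu').1.symm (hm v v' hv').1.symm
      (hmono (by omega) hu' hv' huv)
  have gmono : ∀ {u v}, u ∈ S → v ∈ S → s u ≤ s v → g u ≤ g v :=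
    fun hu hv huv => descentRank_mono hS hT hu hv huv
  have κmono : ∀ u v u' v', G.Adj u u' → G.Adj v v' → c u = c v → s u ≤ s v → κ u ≤ κ v := by
    intro u v u' v' hu hv hc huv
    by_cases h0 : c u = 0
    · rw [κ0 u h0, κ0 v (by omega)]
      have := gmono ⟨h0, u', hu⟩ ⟨hc ▸ h0, v', hv⟩ huv
      omega
    · rw [κ1 u h0, κ1 v (by omega)]
      have := gmono (hmS u u' hu h0) (hmS v v' hv (by omega)) (hmono hc hu hv huv)
      omega
  have κstep : ∀ v ∈ S, s (m (m v)) < s v → κ v = κ (m v) + 1 := by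
    intro v hv hlt
    rw [κ0 v hv.1, κ1 _ (hm1 v hv), hg, descentRank_of_lt hlt]
    ring
  refine ⟨κ, fun v => ?_, κmono, fun u v huv => ?_, fun v v' hv => ?_⟩
  · by_cases h0 : c v = 0
    · rw [κ0 v h0, h0]; simp
    · rw [κ1 v h0]; omega
  · have hmu := hm u v huv
    have hcu := h.color_ne u v huv
    by_cases h0 : c u = 0
    · have huS : u ∈ S := ⟨h0, v, huv⟩
      have h1 := hm1 u huS
      have hv0 : c v ≠ 0 := by omega
      by_cases hroot : s (m (m u)) < s u
      · rw [κstep u huS hroot]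
        have := κmono (m u) v u u hmu.1.symm huv.symm (by omega) hmu.2
        omega
      · have h2 : s (m (m u)) ≤ s (m v) := hmono (by omega) hmu.1.symm huv.symm hmu.2
        have := gmono huS (hmS v u huv.symm hv0) (by omega)
        rw [κ0 u h0, κ1 v hv0]
        omega
    · have := gmono (hmS u v huv h0) ⟨by omega, u, huv.symm⟩ hmu.2
      rw [κ1 u h0, κ0 v (by omega)]
      omega
  · by_cases h0 : c v = 0
    · have hvS : v ∈ S := ⟨h0, v', hv⟩
      by_cases hroot : s (m (m v)) < s v
      · exact Or.inl (κstep v hvS hroot)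
      · refine Or.inr fun w w' hw hκw => ?_
        rw [κ0 v h0] at hκw
        have hw0 : c w ≠ 0 := by
          intro hw0
          rw [κ0 w hw0] at hκw
          omega
        rw [κ1 w hw0] at hκw
        exact eq_of_descentRank_eq h.injective hS hT (hmS w w' hw hw0) hvS hroot
          (by change g (m w) = g v; omega)
    · left
      rw [κ1 v h0, κ0 _ (hmS v v' hv h0).1]

theorem adj_of_layers (h : IsStrongOrdering G c s) {m : V → V}
    (hm : ∀ v w, G.Adj v w → G.Adj v (m v) ∧ s (m v) ≤ s w) {κ : V → ℕ}
    (hmono : ∀ u v u' v', G.Adj u u' → G.Adj v v' → c u = c v → s u ≤ s v → κ u ≤ κ v)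
    (hroot : ∀ v v', G.Adj v v' → κ v = κ (m v) + 1 ∨
      ∀ w w', G.Adj w w' → κ w = κ v + 1 → m w = v)
    {x x' y y' u v : V} (hxy : G.Adj x y) (hx' : G.Adj x' u) (hy' : G.Adj y' v)
    (hcx : c x = c x') (hcy : c y' = c y) (hsx : s x ≤ s x') (hsy : s y' ≤ s y)
    (hκ : κ y' = κ x' + 1) : G.Adj x' y' := by
  have hw := (hm x' u hx').1
  have hz := (hm y' v hy').1
  have hc := h.color_ne x y hxy
  have hcw := h.color_ne _ _ hw
  have hcz := h.color_ne _ _ hz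
  by_cases hlt : s (m x') < s y'
  · have hx'y : G.Adj x' y := by
      rcases hsx.eq_or_lt with e | hsx
      · rwa [← h.injective e]
      · exact (h.cross x x' (m x') y hcx hsx (hlt.trans_le hsy) hxy hw).2
    exact (h.adj_of_between (by omega) hcy hlt.le hsy hw.symm hx'y.symm hy').symm
  by_cases hgt : s x' < s (m y')
  · have hxy' : G.Adj x y' := by
      rcases hsy.eq_or_lt with e | hsy
      · rwa [h.injective e]
      · exact (h.cross x (m y') y' y (by omega) (hsx.trans_lt hgt) hsy hxy hz.symm).1
    exact h.adj_of_between hcx (by omega) hsx hgt.le hxy' hz.symm hx'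
  rcases hroot x' u hx' with hr | hr
  · have := hmono y' (m x') v x' hy' hw.symm (by omega) (by omega)
    omega
  · rw [hr y' v hy' hκ] at hz
    exact hz.symm

end IsStrongOrdering

theorem exists_equiv_monotone {V α : Type*} [Fintype V] [LinearOrder α] (f : V → α) :
    ∃ e : Fin (Fintype.card V) ≃ V, Monotone (f ∘ e) :=
  ⟨(Tuple.sort (f ∘ (Fintype.equivFin V).symm)).trans (Fintype.equivFin V).symm,
    Tuple.monotone_sort (f ∘ (Fintype.equivFin V).symm)⟩

theorem IsStrongOrdering.exists_umbrella_free {V : Type*} [Fintype V] {G : SimpleGraph V}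
    {c : V → Fin 2} {s : V → ℕ} (h : IsStrongOrdering G c s) :
    ∃ e : Fin (Fintype.card V) ≃ V, ∀ i a b k, i ≤ a → a < b → b ≤ k → G.Adj (e i) (e k) →
      c (e a) ≠ c (e b) → G.Adj (e a) (e b) := by
  classical
  have hex : ∀ v, ∃ w, ∀ w', G.Adj v w' → G.Adj v w ∧ s w ≤ s w' := by
    intro v
    by_cases hv : ∃ w, G.Adj v w
    · obtain ⟨w, hw, hmin⟩ := Set.exists_min_image {w | G.Adj v w} s (Set.toFinite _) hv
      exact ⟨w, fun w' hw' => ⟨hw, hmin w' hw'⟩⟩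
    · exact ⟨v, fun w' hw' => (hv ⟨w', hw'⟩).elim⟩
  choose m hm using hex
  obtain ⟨κ, hpar, hmono, hadj, hroot⟩ := h.exists_layering hm
  set key : V → ℕ∞ := fun v => if ∃ w, G.Adj v w then (κ v : ℕ∞) else ⊤ with hkey
  obtain ⟨e, he⟩ := exists_equiv_monotone fun v => toLex (key v, s v)
  refine ⟨e, fun i a b k hia hab hbk hik hc => ?_⟩
  have key_of_adj : ∀ v w, G.Adj v w → key v = κ v := fun v w hvw => if_pos ⟨w, hvw⟩
  have hle : ∀ {i j}, i ≤ j → key (e i) < key (e j) ∨ key (e i) = key (e j) ∧ s (e i) ≤ s (e j) :=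
    fun hij => (Prod.Lex.toLex_le_toLex).1 (he hij)
  have hle' : ∀ {i j}, i ≤ j → key (e i) ≤ key (e j) := fun hij => by
    rcases hle hij with h | h
    exacts [h.le, h.1.le]
  have hki := key_of_adj _ _ hik
  have hkk := key_of_adj _ _ hik.symm
  have hnon : ∀ j, j ≤ k → ∃ w, G.Adj (e j) w := by
    intro j hj
    by_contra hno
    have h1 := hle' hj
    rw [hkk, hkey] at h1
    simp [hno] at h1
  obtain ⟨a', ha'⟩ := hnon a (hab.le.trans hbk)
  obtain ⟨b', hb'⟩ := hnon b hbk
  have hka := key_of_adj _ _ ha'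
  have hkb := key_of_adj _ _ hb'
  have h1 := hle hia
  have h2 := hle' hab.le
  have h3 := hle hbk
  rw [hki, hka] at h1
  rw [hka, hkb] at h2
  rw [hkb, hkk] at h3
  norm_cast at h1 h2 h3
  have h4 := hadj _ _ hik.symm
  have h5 := h.color_ne _ _ hik
  have p1 := hpar (e i)
  have p2 := hpar (e a)
  have p3 := hpar (e b)
  have p4 := hpar (e k)
  exact h.adj_of_layers hm hmono hroot hik ha' hb' (by omega) (by omega) (by omega) (by omega)
    (by omega)

/-- A hereditary relation on pairs of indices is realised by unit distances on the line. -/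
theorem exists_unit_positions (H : ℕ → ℕ → Prop)
    (hH : ∀ i a b k, i ≤ a → a < b → b ≤ k → H i k → H a b) (n : ℕ) :
    ∃ a : ℕ → ℝ, ∀ k < n, ∀ i < k,
      a i < a k ∧ (H i k → a k < a i + 1) ∧ (¬ H i k → a i + 1 < a k) := by
  classical
  induction n with
  | zero => exact ⟨0, by simp⟩
  | succ n ih =>
    obtain ⟨a, ha⟩ := ih
    obtain ⟨t, hlo, hhi⟩ := Order.exists_between_finsets
      ((Finset.range n).image a ∪ ((Finset.range n).filter fun i => ¬ H i n).image (a · + 1))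
      (((Finset.range n).filter fun i => H i n).image (a · + 1)) (by
        simp only [Finset.mem_union, Finset.mem_image, Finset.mem_range, Finset.mem_filter]
        rintro _ (⟨i, hi, rfl⟩ | ⟨i, ⟨hi, hni⟩, rfl⟩) _ ⟨j, ⟨hj, hHj⟩, rfl⟩
        · rcases lt_trichotomy i j with hij | rfl | hij
          · linarith [(ha j hj i hij).1]
          · linarith
          · exact (ha i hi j hij).2.1 (hH j j i n le_rfl hij hi.le hHj)
        · have hij : i < j := by
            by_contra! hji
            exact hni (hH j i n n hji hi le_rfl hHj)
          linarith [(ha j hj i hij).1])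
    simp only [Finset.mem_union, Finset.mem_image, Finset.mem_range, Finset.mem_filter] at hlo hhi
    refine ⟨Function.update a n t, fun k hk i hi => ?_⟩
    rw [Function.update_of_ne (by omega : i ≠ n)]
    rcases (Nat.lt_succ_iff.1 hk).eq_or_lt with rfl | hk
    · rw [Function.update_self]
      exact ⟨hlo _ (.inl ⟨i, hi, rfl⟩), fun h => hhi _ ⟨i, ⟨hi, h⟩, rfl⟩,
        fun h => hlo _ (.inr ⟨i, ⟨hi, h⟩, rfl⟩)⟩
    · rw [Function.update_of_ne hk.ne]
      exact ha k hk i hi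

theorem exists_unit_positions_of_umbrella_free {V : Type*} [Fintype V] {G : SimpleGraph V}
    {c : V → Fin 2} {e : Fin (Fintype.card V) ≃ V}
    (he : ∀ i a b k, i ≤ a → a < b → b ≤ k → G.Adj (e i) (e k) →
      c (e a) ≠ c (e b) → G.Adj (e a) (e b)) :
    ∃ a : V → ℝ, Function.Injective a ∧ ∀ u v, c u ≠ c v →
      (G.Adj u v → |a u - a v| < 1) ∧ (¬ G.Adj u v → 1 < |a u - a v|) := by
  obtain ⟨a, ha⟩ := exists_unit_positions
    (fun i k => ∃ i' k' : Fin (Fintype.card V), i'.val ≤ i ∧ k ≤ k'.val ∧ G.Adj (e i') (e k'))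
    (fun i a b k hia _ hbk ⟨i', k', hi, hk, hadj⟩ =>
      ⟨i', k', hi.trans hia, hbk.trans hk, hadj⟩) (Fintype.card V)
  have key : ∀ i k : Fin (Fintype.card V), i < k → c (e i) ≠ c (e k) →
      (G.Adj (e i) (e k) → |a i - a k| < 1) ∧ (¬ G.Adj (e i) (e k) → 1 < |a i - a k|) := by
    intro i k hik hc
    obtain ⟨h1, h2, h3⟩ := ha k k.2 i hik
    rw [abs_sub_comm, abs_of_pos (by linarith)]
    refine ⟨fun h => ?_, fun h => ?_⟩
    · linarith [h2 ⟨i, k, le_rfl, le_rfl, h⟩]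
    · have := h3 fun ⟨i', k', hi, hk, hadj⟩ => h (he i' i k k' hi hik hk hadj hc)
      linarith
  refine ⟨fun v => a (e.symm v), fun u v huv => ?_, fun u v hc => ?_⟩
  · by_contra hne
    rcases lt_or_gt_of_ne (e.symm.injective.ne hne) with h | h
    · exact (ha _ (e.symm v).2 _ h).1.ne huv
    · exact (ha _ (e.symm u).2 _ h).1.ne huv.symm
  · have hne : u ≠ v := fun h => hc (h ▸ rfl)
    rcases lt_or_gt_of_ne (e.symm.injective.ne hne) with h | h
    · simpa using key _ _ h (by simpa using hc)
    · rw [G.adj_comm, abs_sub_comm]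
      simpa using key _ _ h (by simpa using hc.symm)

theorem GoodOrdering.of_umbrella_free {V : Type*} [Fintype V] {G : SimpleGraph V} {c : V → Fin 2}
    (hc : ∀ u v, G.Adj u v → c u ≠ c v) {e : Fin (Fintype.card V) ≃ V}
    (he : ∀ i a b k, i ≤ a → a < b → b ≤ k → G.Adj (e i) (e k) →
      c (e a) ≠ c (e b) → G.Adj (e a) (e b)) : GoodOrdering G :=
  ⟨c, e, hc, fun i j k hij hjk hik =>
    ⟨fun h => (he i i j k le_rfl hij hjk.le hik h).symm,
      fun h => he i j k k hij.le hjk le_rfl hik h.symm⟩⟩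

theorem Icc_inter_Icc_nonempty_iff {a b a' b' : ℝ} (h : a ≤ b) (h' : a' ≤ b') :
    (Set.Icc a b ∩ Set.Icc a' b').Nonempty ↔ a ≤ b' ∧ a' ≤ b := by
  rw [Set.Icc_inter_Icc, Set.nonempty_Icc]
  simp only [sup_le_iff, le_inf_iff]
  tauto

section Positions

variable {V : Type*} {G : SimpleGraph V} {c : V → Fin 2} {a : V → ℝ}

theorem isIntervalKRep_of_unit_positions (hc : ∀ u v, G.Adj u v → c u ≠ c v)
    (ha : ∀ u v, c u ≠ c v → (G.Adj u v → |a u - a v| < 1) ∧ (¬ G.Adj u v → 1 < |a u - a v|)) :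
    IsIntervalKRep G 2 a (fun v => a v + 1) c := by
  refine ⟨fun v => by linarith, fun u v _ => ?_⟩
  rw [Icc_inter_Icc_nonempty_iff (by linarith) (by linarith)]
  constructor
  · intro h
    have := abs_lt.1 ((ha u v (hc u v h)).1 h)
    exact ⟨hc u v h, by linarith, by linarith⟩
  · rintro ⟨hne, h1, h2⟩
    by_contra h
    have := (ha u v hne).2 h
    have := abs_le.2 (⟨by linarith, by linarith⟩ : -1 ≤ a u - a v ∧ a u - a v ≤ 1)
    linarith

theorem isPermutationGraph_of_unit_positions (hc : ∀ u v, G.Adj u v → c u ≠ c v)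
    (hinj : Function.Injective a)
    (ha : ∀ u v, c u ≠ c v → (G.Adj u v → |a u - a v| < 1) ∧ (¬ G.Adj u v → 1 < |a u - a v|)) :
    IsPermutationGraph G := by
  have hne : ∀ u v, c u ≠ c v → |a u - a v| ≠ 1 := by
    intro u v h
    by_cases hadj : G.Adj u v
    · exact ((ha u v h).1 hadj).ne
    · exact ((ha u v h).2 hadj).ne'
  have hinj' : ∀ t : ℝ, |t| = 1 → Function.Injective fun v => if c v = 0 then a v else a v + t := by
    intro t ht u v huv
    dsimp only at huv
    by_cases h : c u = c v
    · rw [h] at huv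
      split_ifs at huv
      · exact hinj huv
      · exact hinj (add_right_cancel huv)
    · refine (hne u v h ?_).elim
      split_ifs at huv
      · omega
      · rw [huv, add_sub_cancel_left, ht]
      · rw [← huv, sub_add_cancel_left, abs_neg, ht]
      · omega
  refine ⟨_, _, hinj' (-1) (by simp), hinj' 1 (by simp), fun u v huv => ?_⟩
  have hauv := hinj.ne huv
  by_cases h : c u = c v
  · have : ¬ G.Adj u v := fun hadj => hc u v hadj h
    rw [h]
    split_ifs <;> simp only [this, add_lt_add_iff_right, false_iff] <;> grind
  · have h' := ha u v h
    have habs := abs_lt (a := a u - a v) (b := 1)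
    have hge := lt_abs (a := 1) (b := a u - a v)
    split_ifs
    · omega
    · by_cases hadj : G.Adj u v
      · have := habs.1 (h'.1 hadj)
        simp only [hadj, true_iff]
        constructor <;> intro <;> linarith
      · have := hge.1 (h'.2 hadj)
        simp only [hadj, false_iff]
        rcases this with h | h <;> intro h2
        · exact absurd (h2.2 (by linarith)) (by linarith)
        · exact absurd (h2.1 (by linarith)) (by linarith)
    · by_cases hadj : G.Adj u v
      · have := habs.1 (h'.1 hadj)
        simp only [hadj, true_iff]
        constructor <;> intro <;> linarith
      · have := hge.1 (h'.2 hadj)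
        simp only [hadj, false_iff]
        rcases this with h | h <;> intro h2
        · exact absurd (h2.2 (by linarith)) (by linarith)
        · exact absurd (h2.1 (by linarith)) (by linarith)
    · omega

end Positions

theorem UnitRep.properRep {V : Type*} {L R : V → ℝ} (h : UnitRep L R) (hLR : ∀ v, L v ≤ R v) :
    ProperRep L R := by
  intro u v _ hss
  obtain ⟨h1, h2⟩ := (Set.Icc_subset_Icc_iff (hLR u)).1 hss.1
  exact hss.2 (Set.Icc_subset_Icc (by linarith [h u v]) (by linarith [h u v]))

section StrongOrdering

variable {V : Type*} [Fintype V] {G : SimpleGraph V}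

theorem exists_isStrongOrdering_of_classProperRep {L R : V → ℝ} {c : V → Fin 2}
    (hrep : IsIntervalKRep G 2 L R c) (hcp : ClassProperRep L R c) :
    ∃ s, IsStrongOrdering G c s := by
  obtain ⟨hLR, hadj⟩ := hrep
  obtain ⟨e, he⟩ := exists_equiv_monotone L
  have hL : ∀ u v, e.symm u < e.symm v → L u ≤ L v := fun u v h => by simpa using he h.le
  have hR : ∀ u v, c u = c v → e.symm u < e.symm v → R u ≤ R v := by
    intro u v hc h
    by_contra! hlt
    refine hcp v u (by rintro rfl; exact h.false) hc.symm
      ⟨Set.Icc_subset_Icc (hL u v h) hlt.le, fun hs => ?_⟩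
    exact hlt.not_ge ((Set.Icc_subset_Icc_iff (hLR u)).1 hs).2
  have hiff : ∀ u v, c u ≠ c v → (G.Adj u v ↔ L u ≤ R v ∧ L v ≤ R u) := by
    intro u v hc
    rw [hadj u v (fun h => hc (h ▸ rfl)), Icc_inter_Icc_nonempty_iff (hLR u) (hLR v)]
    exact and_iff_right hc
  have hne : ∀ u v, G.Adj u v → c u ≠ c v := fun u v h => ((hadj u v h.ne).1 h).1
  refine ⟨fun v => e.symm v, Fin.val_injective.comp e.symm.injective, hne, ?_⟩
  intro x x' y y' hc hx hy h1 h2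
  have c1 := hne _ _ h1
  have c2 := hne _ _ h2
  have hc' : c y = c y' := by omega
  rw [hiff _ _ c1] at h1
  rw [hiff _ _ c2] at h2
  have := hL x x' hx
  have := hL y y' hy
  have := hR x x' hc hx
  have := hR y y' hc' hy
  rw [hiff x y (by omega), hiff x' y' (by omega)]
  refine ⟨⟨?_, ?_⟩, ?_, ?_⟩ <;> linarith

theorem IsPermutationGraph.exists_isStrongOrdering (h : IsPermutationGraph G) {c : V → Fin 2}
    (hc : ∀ u v, G.Adj u v → c u ≠ c v) : ∃ s, IsStrongOrdering G c s := by
  obtain ⟨p, q, hp, hq, hadj⟩ := h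
  obtain ⟨e, he⟩ := exists_equiv_monotone p
  have hpl : ∀ u v, e.symm u < e.symm v → p u < p v := fun u v h =>
    lt_of_le_of_ne (by simpa using he h.le) (hp.ne (by rintro rfl; exact h.false))
  have hql : ∀ u v, c u = c v → e.symm u < e.symm v → q u < q v := by
    intro u v huv h
    have hne : u ≠ v := by rintro rfl; exact h.false
    have hn : ¬ G.Adj u v := fun h => hc u v h huv
    rw [hadj u v hne] at hn
    have := hpl u v h
    have := hq.ne hne
    grind
  have hiff : ∀ u v, c u ≠ c v →
      (G.Adj u v ↔ (p u < p v ∧ q v < q u) ∨ (p v < p u ∧ q u < q v)) := by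
    intro u v huv
    have hne : u ≠ v := fun h => huv (h ▸ rfl)
    rw [hadj u v hne]
    have := hp.ne hne
    have := hq.ne hne
    grind
  refine ⟨fun v => e.symm v, Fin.val_injective.comp e.symm.injective, hc, ?_⟩
  intro x x' y y' hcx hx hy h1 h2
  have c1 := hc _ _ h1
  have c2 := hc _ _ h2
  have hcy : c y = c y' := by omega
  rw [hiff _ _ c1] at h1
  rw [hiff _ _ c2] at h2
  have := hpl x x' hx
  have := hpl y y' hy
  have := hql x x' hcx hx
  have := hql y y' hcy hy
  rw [hiff x y (by omega), hiff x' y' (by omega)]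
  grind

theorem GoodOrdering.exists_isStrongOrdering (h : GoodOrdering G) :
    ∃ c s, IsStrongOrdering G c s := by
  obtain ⟨c, e, hc, he⟩ := h
  have key : ∀ u v w, e.symm u < e.symm v → e.symm v < e.symm w → G.Adj u w →
      (c u ≠ c v → G.Adj v u) ∧ (c w ≠ c v → G.Adj v w) := fun u v w huv hvw h => by
    simpa using he _ _ _ huv hvw (by simpa using h)
  refine ⟨c, fun v => e.symm v, Fin.val_injective.comp e.symm.injective, hc, ?_⟩
  -- The edges `x y'` and `x' y` are handled up to exchanging the roles of the two color classes.
  have main : ∀ x x' y y', c x = c x' → e.symm x < e.symm x' → e.symm y < e.symm y' →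
      G.Adj x y' → G.Adj x' y → e.symm x < e.symm y → G.Adj x y ∧ G.Adj x' y' := by
    intro x x' y y' hcx hx hy h1 h2 hxy
    have c1 := hc _ _ h1
    have c2 := hc _ _ h2
    refine ⟨((key x y y' hxy hy h1).1 (by omega)).symm, ?_⟩
    have hne : e.symm x' ≠ e.symm y' := e.symm.injective.ne (by rintro rfl; exact c1 hcx)
    rcases lt_or_gt_of_ne hne with h | h
    · exact (key x x' y' hx h h1).2 (by omega)
    · exact ((key y y' x' hy h h2.symm).2 (by omega)).symm
  intro x x' y y' hcx hx hy h1 h2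
  have c1 := hc _ _ h1
  have c2 := hc _ _ h2
  have hne : e.symm x ≠ e.symm y := e.symm.injective.ne (by rintro rfl; exact c2 hcx.symm)
  rcases lt_or_gt_of_ne hne with h | h
  · exact main x x' y y' hcx hx hy h1 h2 h
  · have := main y y' x x' (by omega) hy hx h2.symm h1.symm h
    exact ⟨this.1.symm, this.2.symm⟩

end StrongOrdering

/-- For a finite bipartite graph `G`, the following are
equivalent: (1) `G` is a unit interval bigraph; (2) `G` is a proper interval
bigraph; (3) `G` is a class-proper interval 2-graph; (4) `G` is a permutation
graph; (5) `G` admits a good ordering. -/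
theorem interval_bigraph_tfae {V : Type*} [Fintype V] (G : SimpleGraph V)
    (hbip : ∃ c : V → Fin 2, ∀ u v : V, G.Adj u v → c u ≠ c v) :
    List.TFAE
      [ ∃ (L R : V → ℝ) (c : V → Fin 2), IsIntervalKRep G 2 L R c ∧ UnitRep L R,
        ∃ (L R : V → ℝ) (c : V → Fin 2), IsIntervalKRep G 2 L R c ∧ ProperRep L R,
        ∃ (L R : V → ℝ) (c : V → Fin 2), IsIntervalKRep G 2 L R c ∧ ClassProperRep L R c,
        IsPermutationGraph G,
        GoodOrdering G ] := by
  have of_strong : (∃ c s, IsStrongOrdering G c s) →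
      (∃ (L R : V → ℝ) (c : V → Fin 2), IsIntervalKRep G 2 L R c ∧ UnitRep L R) ∧
        IsPermutationGraph G ∧ GoodOrdering G := by
    rintro ⟨c, s, h⟩
    obtain ⟨e, he⟩ := h.exists_umbrella_free
    obtain ⟨a, hinj, ha⟩ := exists_unit_positions_of_umbrella_free he
    exact ⟨⟨a, fun v => a v + 1, c, isIntervalKRep_of_unit_positions h.color_ne ha,
        fun u v => by ring⟩,
      isPermutationGraph_of_unit_positions h.color_ne hinj ha,
      GoodOrdering.of_umbrella_free h.color_ne he⟩
  have strong_of_classProper :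
      (∃ (L R : V → ℝ) (c : V → Fin 2), IsIntervalKRep G 2 L R c ∧ ClassProperRep L R c) →
        ∃ c s, IsStrongOrdering G c s :=
    fun ⟨_, _, c, hrep, hcp⟩ => ⟨c, exists_isStrongOrdering_of_classProperRep hrep hcp⟩
  tfae_have 1 → 2 := fun ⟨L, R, c, hrep, hu⟩ => ⟨L, R, c, hrep, hu.properRep hrep.1⟩
  tfae_have 2 → 3 := fun ⟨L, R, c, hrep, hp⟩ => ⟨L, R, c, hrep, fun u v huv _ => hp u v huv⟩
  tfae_have 3 → 4 := fun h => (of_strong (strong_of_classProper h)).2.1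
  tfae_have 4 → 5 := fun h =>
    let ⟨c, hc⟩ := hbip
    (of_strong ⟨c, h.exists_isStrongOrdering hc⟩).2.2
  tfae_have 5 → 1 := fun h => (of_strong h.exists_isStrongOrdering).1
  tfae_finish
end

section
/- Every class-proper interval 2-graph is a permutation graph. -/
/-- An injective map from a finite type to a linear order can be replaced by a real-valued one
inducing the same order. -/
theorem exists_real_lt_iff_lt {V α : Type*} [Finite V] [LinearOrder α] (f : V → α)
    (hf : Function.Injective f) :
    ∃ p : V → ℝ, Function.Injective p ∧ ∀ u v, p u < p v ↔ f u < f v := by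
  obtain ⟨e⟩ := Order.embedding_from_countable_to_dense (Set.range f) ℝ
  refine ⟨fun v => e ⟨f v, v, rfl⟩, fun u v h => hf ?_, fun u v => ?_⟩
  · exact congrArg Subtype.val (e.injective h)
  · exact e.lt_iff_lt.trans Iff.rfl

/-- A finite family of reals, with ties broken first by the colors `d` and then by an injective
index `g`, can be realized by an injective family of reals. -/
theorem exists_real_lt_iff_lex {V : Type*} [Finite V] (a : V → ℝ) (d : V → Fin 2) (g : V → ℕ)
    (hg : Function.Injective g) :
    ∃ p : V → ℝ, Function.Injective p ∧ ∀ u v, p u < p v ↔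
      a u < a v ∨ a u = a v ∧ (d u < d v ∨ d u = d v ∧ g u < g v) := by
  obtain ⟨p, hp, h⟩ := exists_real_lt_iff_lt
    (fun v => toLex (a v, toLex (d v, g v)))
    (fun u v h => hg (by simpa using congrArg (fun x => (ofLex (ofLex x).2).2) h))
  exact ⟨p, hp, fun u v => by simpa [Prod.Lex.toLex_lt_toLex] using h u v⟩

/-- Two intervals in the same class of a class-proper representation have their left endpoints
in the same order as their right endpoints. -/
theorem ClassProperRep.left_lt_left_iff {V : Type*} {k : ℕ} {L R : V → ℝ} {c : V → Fin k}
    (hLR : ∀ v, L v ≤ R v) (h : ClassProperRep L R c) {u v : V} (hc : c u = c v) :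
    L u < L v ↔ R u < R v := by
  rcases eq_or_ne u v with rfl | huv
  · simp
  have h₁ := h u v huv hc
  have h₂ := h v u huv.symm hc.symm
  simp only [ssubset_iff_subset_not_subset, Set.Icc_subset_Icc_iff (hLR _)] at h₁ h₂
  grind

/-- Every (finite) class-proper interval 2-graph is a
permutation graph. -/
theorem classProper_interval2_isPermutationGraph {V : Type*} [Fintype V]
    (G : SimpleGraph V)
    (h : ∃ (L R : V → ℝ) (c : V → Fin 2),
      IsIntervalKRep G 2 L R c ∧ ClassProperRep L R c) :
    IsPermutationGraph G := by
  obtain ⟨L, R, c, ⟨hLR, hadj⟩, hproper⟩ := h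
  obtain ⟨g, hg⟩ := exists_injective_nat V
  obtain ⟨p, hp, hplt⟩ :=
    exists_real_lt_iff_lex (fun v => if c v = 0 then L v else R v) c g hg
  obtain ⟨q, hq, hqlt⟩ :=
    exists_real_lt_iff_lex (fun v => if c v = 0 then R v else L v) (fun v => (c v).rev) g hg
  refine ⟨p, q, hp, hq, fun u v huv => ?_⟩
  have hguv : g u ≠ g v := hg.ne huv
  have hu := hLR u
  have hv := hLR v
  rw [hadj u v huv, hplt, hqlt, Set.Icc_inter_Icc, Set.nonempty_Icc]
  have hsame := fun hc : c u = c v => hproper.left_lt_left_iff hLR hc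
  have hsame' := fun hc : c v = c u => hproper.left_lt_left_iff hLR hc
  have hcu : c u = 0 ∨ c u = 1 := by lia
  have hcv : c v = 0 ∨ c v = 1 := by lia
  rcases hcu with hcu | hcu <;> rcases hcv with hcv | hcv <;>
    simp [hcu, hcv] at hsame hsame' ⊢ <;> grind
end

section
/- If a finite bipartite graph G is a permutation graph, then G admits a proper 2-coloring c and an enumeration v_1, …, v_n of its vertices such that whenever v_i v_k is an edge and i < j < k, the vertex v_j is adjacent to whichever of v_i, v_k has a color different from c(v_j). -/
/-- A finite type can be enumerated in strictly increasing order of an injective real key. -/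
theorem exists_enumeration_strictMono {V : Type*} [Fintype V] (p : V → ℝ)
    (hp : Function.Injective p) :
    ∃ e : Fin (Fintype.card V) ≃ V, StrictMono (p ∘ e) := by
  let _ : LinearOrder V := LinearOrder.lift' p hp
  refine ⟨(monoEquivOfFin V rfl).toEquiv, fun i j hij => ?_⟩
  exact (monoEquivOfFin V rfl).strictMono hij

/-- If a finite bipartite graph `G` is a permutation graph,
then `G` admits a proper 2-coloring and an enumeration of its vertices with the
good ordering property. -/
theorem bipartite_permutation_goodOrdering {V : Type*} [Fintype V]
    (G : SimpleGraph V)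
    (hbip : ∃ c : V → Fin 2, ∀ u v : V, G.Adj u v → c u ≠ c v)
    (hperm : IsPermutationGraph G) :
    GoodOrdering G := by
  obtain ⟨c, hc⟩ := hbip
  obtain ⟨p, q, hp, hq, hadj⟩ := hperm
  obtain ⟨e, he⟩ := exists_enumeration_strictMono p hp
  refine ⟨c, e, hc, fun i j k hij hjk hik => ?_⟩
  have hpij : p (e i) < p (e j) := he hij
  have hpjk : p (e j) < p (e k) := he hjk
  have hij' : e i ≠ e j := e.injective.ne hij.ne
  have hjk' : e j ≠ e k := e.injective.ne hjk.ne
  have hik' : e i ≠ e k := e.injective.ne (hij.trans hjk).ne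
  have hqki : q (e k) < q (e i) := ((hadj _ _ hik').1 hik).1 (hpij.trans hpjk)
  have hcik := hc _ _ hik
  constructor
  · intro h
    have hcjk : c (e j) = c (e k) := by omega
    have hqjk : q (e j) ≤ q (e k) := by
      by_contra! hlt
      exact hc _ _ ((hadj _ _ hjk').2 (iff_of_true hpjk hlt)) hcjk
    exact ((hadj _ _ hij').2 (iff_of_true hpij (hqjk.trans_lt hqki))).symm
  · intro h
    have hcij : c (e i) = c (e j) := by omega
    have hqij : q (e i) ≤ q (e j) := by
      by_contra! hlt
      exact hc _ _ ((hadj _ _ hij').2 (iff_of_true hpij hlt)) hcij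
    exact (hadj _ _ hjk').2 (iff_of_true hpjk (hqki.trans_le hqij))
end

section
/- Let G be a finite simple graph admitting a proper 2-coloring c and an enumeration v_1, …, v_n of its vertices such that whenever v_i v_k is an edge and i < j < k, the vertex v_j is adjacent to whichever of v_i, v_k has a color different from c(v_j). Then G is a unit interval bigraph. -/
/-- On a finite linear order, a relation `Far` contained in `<` and closed under moving its
arguments apart is realised by real positions: strictly increasing ones whose difference exceeds
`1` on `Far` pairs and is less than `1` on the other pairs. -/
lemma exists_positions_of_far {α : Type*} [LinearOrder α] (Far : α → α → Prop)
    (far_mono : ∀ i' i k k', i' ≤ i → k ≤ k' → Far i k → Far i' k') (s : Finset α) :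
    ∃ p : α → ℝ, ∀ i ∈ s, ∀ k ∈ s, i < k →
      p i < p k ∧ (Far i k → p i + 1 < p k) ∧ (¬ Far i k → p k < p i + 1) := by
  classical
  induction s using Finset.induction_on_max with
  | empty => exact ⟨fun _ => 0, by simp⟩
  | insert a s hmax ih =>
    obtain ⟨p, hp⟩ := ih
    have hbetween : ∀ x ∈ s.image p ∪ (s.filter (Far · a)).image (p · + 1),
        ∀ y ∈ (s.filter (¬ Far · a)).image (p · + 1), x < y := by
      intro x hx y hy
      simp only [Finset.mem_union, Finset.mem_image, Finset.mem_filter] at hx hy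
      obtain ⟨j, ⟨hj, hja⟩, rfl⟩ := hy
      rcases hx with ⟨i, hi, rfl⟩ | ⟨i, ⟨hi, hia⟩, rfl⟩
      · rcases lt_trichotomy i j with hij | rfl | hij
        · linarith [(hp i hi j hj hij).1]
        · linarith
        · exact (hp j hj i hi hij).2.2
            fun h => hja (far_mono _ _ _ _ le_rfl (hmax i hi).le h)
      · have hij : i < j := by
          by_contra! hji
          exact hja (far_mono _ _ _ _ hji le_rfl hia)
        linarith [(hp i hi j hj hij).1]
    obtain ⟨t, hlo, hhi⟩ := Order.exists_between_finsets _ _ hbetween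
    simp only [Finset.mem_union, Finset.mem_image, Finset.mem_filter] at hlo hhi
    refine ⟨Function.update p a t, fun i hi k hk hik => ?_⟩
    rcases Finset.mem_insert.1 hi with rfl | his
    · rcases Finset.mem_insert.1 hk with rfl | hks
      · exact absurd hik (lt_irrefl _)
      · exact absurd hik (hmax k hks).not_gt
    · rw [Function.update_of_ne (hmax i his).ne]
      rcases Finset.mem_insert.1 hk with rfl | hks
      · rw [Function.update_self]
        exact ⟨hlo _ (Or.inl ⟨i, his, rfl⟩), fun h => hlo _ (Or.inr ⟨i, ⟨his, h⟩, rfl⟩),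
          fun h => hhi _ ⟨i, ⟨his, h⟩, rfl⟩⟩
      · rw [Function.update_of_ne (hmax k hks).ne]
        exact hp i his k hks hik

/-- The order of the left endpoints of color `0` and the right endpoints of color `1` in the unit
representation built from the vertex order `pos`. -/
def EndpointLT {V : Type*} (G : SimpleGraph V) (c : V → Fin 2) (pos : V → ℕ) (u v : V) : Prop :=
  (c u = c v ∧ pos u < pos v) ∨
  (c u = 0 ∧ c v = 1 ∧ (pos u < pos v ∨ G.Adj u v)) ∨
  (c u = 1 ∧ c v = 0 ∧ pos u < pos v ∧ ¬ G.Adj u v)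

lemma isStrictTotalOrder_endpointLT {V : Type*} {G : SimpleGraph V} {c : V → Fin 2} {pos : V → ℕ}
    (hpos : Function.Injective pos)
    (hgood : ∀ u v w, pos u < pos v → pos v < pos w → G.Adj u w →
      (c u ≠ c v → G.Adj v u) ∧ (c w ≠ c v → G.Adj v w)) :
    IsStrictTotalOrder V (EndpointLT G c pos) := by
  have hc : ∀ v, c v = 0 ∨ c v = 1 := fun v => by omega
  have symm : ∀ u v, G.Adj u v → G.Adj v u := fun _ _ h => h.symm
  have hne : ∀ u v, pos u = pos v → u = v := fun _ _ h => hpos h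
  refine { trichotomous := fun u v => ?_, irrefl := fun u => ?_, trans := fun u v w => ?_ }
  · have := hc u
    have := hc v
    have := hne u v
    have := symm u v
    have := symm v u
    unfold EndpointLT
    grind
  · simp [EndpointLT]
  · unfold EndpointLT
    rcases hc u with hu | hu <;> rcases hc v with hv | hv <;> rcases hc w with hw | hw <;>
      simp only [hu, hv, hw] <;> grind

/-- A finite simple graph with a good ordering (a proper
2-coloring `c` together with an enumeration `v_1, …, v_n` such that whenever
`v_i v_k` is an edge and `i < j < k`, `v_j` is adjacent to whichever of
`v_i, v_k` has a color different from `c (v_j)`) is a unit interval bigraph. -/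
theorem goodOrdering_unit_interval_bigraph {V : Type*} [Fintype V]
    (G : SimpleGraph V) (h : GoodOrdering G) :
    ∃ (L R : V → ℝ) (c : V → Fin 2), IsIntervalKRep G 2 L R c ∧ UnitRep L R := by
  classical
  obtain ⟨c, e, hcol, hord⟩ := h
  obtain ⟨pos, hpos, hgood⟩ : ∃ pos : V → ℕ, Function.Injective pos ∧
      ∀ u v w, pos u < pos v → pos v < pos w → G.Adj u w →
        (c u ≠ c v → G.Adj v u) ∧ (c w ≠ c v → G.Adj v w) := by
    refine ⟨fun v => e.symm v, Fin.val_injective.comp e.symm.injective, fun u v w huv hvw => ?_⟩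
    simpa using hord (e.symm u) (e.symm v) (e.symm w) huv hvw
  have := isStrictTotalOrder_endpointLT hpos hgood
  let _ : LinearOrder V := linearOrderOfSTO (EndpointLT G c pos)
  have lt_def : ∀ u v : V, u < v ↔ EndpointLT G c pos u v := fun _ _ => Iff.rfl
  have le_pos : ∀ u v : V, c u = c v → u ≤ v → pos u ≤ pos v := by
    intro u v huv hle
    rcases hle.eq_or_lt with rfl | hlt
    · rfl
    · have := (lt_def u v).1 hlt
      unfold EndpointLT at this
      grind
  obtain ⟨p, hp⟩ := exists_positions_of_far
    (fun i k : V => ∃ a b, i ≤ a ∧ b ≤ k ∧ c a = 0 ∧ c b = 1 ∧ pos a < pos b ∧ ¬ G.Adj a b)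
    (fun i' i k k' hi hk ⟨a, b, hia, hbk, hab⟩ => ⟨a, b, hi.trans hia, hbk.trans hk, hab⟩)
    Finset.univ
  simp only [Finset.mem_univ, true_implies] at hp
  have adj_iff : ∀ a b, c a = 0 → c b = 1 → (G.Adj a b ↔ p a ≤ p b ∧ p b ≤ p a + 1) := by
    intro a b ha hb
    have hab : a ≠ b := by
      rintro rfl
      simp [ha] at hb
    constructor
    · intro hadj
      have hlt : a < b := (lt_def a b).2 (Or.inr (Or.inl ⟨ha, hb, Or.inr hadj⟩))
      refine ⟨(hp a b hlt).1.le, ((hp a b hlt).2.2 ?_).le⟩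
      rintro ⟨a', b', haa, hbb, ha', hb', hlt', hnadj⟩
      have h1 := le_pos a a' (ha.trans ha'.symm) haa
      have h2 := le_pos b' b (hb'.trans hb.symm) hbb
      have hab' : G.Adj a b' := by
        rcases h2.eq_or_lt with h2 | h2
        · rwa [hpos h2]
        · exact ((hgood a b' b (h1.trans_lt hlt') h2 hadj).1 (by simp [ha, hb'])).symm
      rcases h1.eq_or_lt with h1 | h1
      · exact hnadj (hpos h1 ▸ hab')
      · exact hnadj ((hgood a a' b' h1 hlt' hab').2 (by simp [ha', hb']))
    · rintro ⟨h1, h2⟩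
      by_contra hnadj
      rcases lt_or_gt_of_ne (hpos.ne hab) with hlt | hlt
      · have hlt' : a < b := (lt_def a b).2 (Or.inr (Or.inl ⟨ha, hb, Or.inl hlt⟩))
        linarith [(hp a b hlt').2.1 ⟨a, b, le_rfl, le_rfl, ha, hb, hlt, hnadj⟩]
      · have hlt' : b < a :=
          (lt_def b a).2 (Or.inr (Or.inr ⟨hb, ha, hlt, fun h => hnadj h.symm⟩))
        linarith [(hp b a hlt').1]
  have hc : ∀ v, c v = 0 ∨ c v = 1 := fun v => by omega
  have inter_iff : ∀ x y : ℝ, (Set.Icc x (x + 1 / 2) ∩ Set.Icc (y - 1 / 2) y).Nonempty ↔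
      x ≤ y ∧ y ≤ x + 1 := by
    intro x y
    rw [Set.Icc_inter_Icc, Set.nonempty_Icc, sup_le_iff, le_inf_iff, le_inf_iff]
    constructor
    · rintro ⟨⟨_, h1⟩, h2, _⟩
      constructor <;> linarith
    · rintro ⟨h1, h2⟩
      refine ⟨⟨?_, ?_⟩, ?_, ?_⟩ <;> linarith
  refine ⟨fun v => if c v = 0 then p v else p v - 1 / 2,
    fun v => if c v = 0 then p v + 1 / 2 else p v, c, ⟨fun v => ?_, fun u v _ => ?_⟩,
    fun u v => ?_⟩
  · dsimp only
    split_ifs <;> linarith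
  · rcases hc u with hu | hu <;> rcases hc v with hv | hv
    · simpa [hu, hv] using fun h => hcol u v h (hu.trans hv.symm)
    · simp only [hu, hv, adj_iff u v hu hv, if_true, one_ne_zero, if_false, inter_iff]
      simp
    · rw [G.adj_comm, adj_iff v u hv hu, Set.inter_comm]
      simp only [hu, hv, if_true, one_ne_zero, if_false, inter_iff]
      simp
    · simpa [hu, hv] using fun h => hcol u v h (hu.trans hv.symm)
  · dsimp only
    split_ifs <;> ring
end

section
/- Let G be a finite simple graph with a proper 2-coloring whose color classes are X and Y, and let v_1, …, v_n be an enumeration of the vertices such that whenever v_i v_k is an edge and i < j < k, the vertex v_j is adjacent to whichever of v_i, v_k lies in the other color class from v_j. List X = x_1, …, x_r and Y = y_1, …, y_s in the order induced by the enumeration. If x_i y_j and x_t y_q are edges of G with i < t and q < j, then x_i y_q and x_t y_j are also edges of G. -/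
/-- **Lemma A.** Let `G` be a finite simple graph with a proper
2-coloring `c` (color classes `X = c⁻¹ 0` and `Y = c⁻¹ 1`) and an enumeration
`e` of its vertices such that whenever `e i — e k` is an edge and `i < j < k`,
the vertex `e j` is adjacent to whichever of `e i, e k` lies in the other color
class.  If `x` precedes `x'` in the induced order on `X`, `y'` precedes `y` in
the induced order on `Y`, and both `x y` and `x' y'` are edges, then `x y'` and
`x' y` are also edges. -/
theorem goodOrdering_strong_ordering {V : Type*} [Fintype V]
    (G : SimpleGraph V) (c : V → Fin 2)
    (hc : ∀ u v : V, G.Adj u v → c u ≠ c v)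
    (e : Fin (Fintype.card V) ≃ V)
    (hord : ∀ i j k : Fin (Fintype.card V), i < j → j < k → G.Adj (e i) (e k) →
      (c (e i) ≠ c (e j) → G.Adj (e j) (e i)) ∧
      (c (e k) ≠ c (e j) → G.Adj (e j) (e k)))
    (x x' y y' : V)
    (hx : c x = 0) (hx' : c x' = 0) (hy : c y = 1) (hy' : c y' = 1)
    (hxx' : e.symm x < e.symm x') (hy'y : e.symm y' < e.symm y)
    (hxy : G.Adj x y) (hx'y' : G.Adj x' y') :
    G.Adj x y' ∧ G.Adj x' y := by
  have hbetween : ∀ u v w : V, e.symm u < e.symm v → e.symm v < e.symm w → G.Adj u w →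
      (c u ≠ c v → G.Adj v u) ∧ (c w ≠ c v → G.Adj v w) := fun u v w huv hvw huw => by
    simpa using hord _ _ _ huv hvw (by simpa using huw)
  have hne : ∀ u v : V, c u = 0 → c v = 1 → e.symm u ≠ e.symm v := fun u v hu hv h => by
    simp [e.symm.injective h, hv] at hu
  constructor
  · rcases (hne x y' hx hy').lt_or_gt with h | h
    · exact ((hbetween x y' y h hy'y hxy).1 (by simp [hx, hy'])).symm
    · exact (hbetween y' x x' h hxx' hx'y'.symm).1 (by simp [hx, hy'])
  · rcases (hne x' y hx' hy).lt_or_gt with h | h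
    · exact (hbetween x x' y hxx' h hxy).2 (by simp [hx', hy])
    · exact ((hbetween y' y x' hy'y h hx'y'.symm).2 (by simp [hx', hy])).symm
end

section
/- If a finite simple graph G is a proper interval k-graph with proper representation (L, R, c), then the vertices of G can be enumerated v_1, …, v_n so that whenever v_i v_k is an edge and i < j < k, the vertex v_j is adjacent to every vertex w among {v_i, v_k} with c(w) ≠ c(v_j). -/
/-- In a proper representation, right endpoints are ordered like left endpoints. -/
theorem ProperRep.right_le_of_left_le {V : Type*} {L R : V → ℝ} (hprop : ProperRep L R)
    (hle : ∀ v, L v ≤ R v) {u v : V} (h : L u ≤ L v) : R u ≤ R v := by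
  by_contra! hlt
  refine hprop v u (fun huv => hlt.ne (congrArg R huv)) ?_
  exact Set.Icc_ssubset_Icc_right (hle u) h hlt

/-- If a finite simple graph `G` is a proper interval
`k`-graph with proper representation `(L, R, c)`, then the vertices of `G` can
be enumerated `v_1, …, v_n` so that whenever `v_i v_k` is an edge and
`i < j < k`, the vertex `v_j` is adjacent to every vertex among `{v_i, v_k}`
whose color differs from that of `v_j`. -/
theorem proper_intervalKGraph_goodOrdering {V : Type*} [Fintype V]
    (G : SimpleGraph V) (k : ℕ) (L R : V → ℝ) (c : V → Fin k)
    (hrep : IsIntervalKRep G k L R c) (hprop : ProperRep L R) :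
    ∃ e : Fin (Fintype.card V) ≃ V,
      ∀ i j m : Fin (Fintype.card V), i < j → j < m → G.Adj (e i) (e m) →
        (c (e i) ≠ c (e j) → G.Adj (e j) (e i)) ∧
        (c (e m) ≠ c (e j) → G.Adj (e j) (e m)) := by
  obtain ⟨hle, hadj⟩ := hrep
  let e₀ : Fin (Fintype.card V) ≃ V := (Fintype.equivFin V).symm
  let e : Fin (Fintype.card V) ≃ V := (Tuple.sort (L ∘ e₀)).trans e₀
  have hL : Monotone (fun i => L (e i)) := Tuple.monotone_sort (L ∘ e₀)
  have hR : Monotone (fun i => R (e i)) := fun i j hij =>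
    hprop.right_le_of_left_le hle (hL hij)
  refine ⟨e, fun i j m hij hjm him => ?_⟩
  obtain ⟨-, x, ⟨-, hxi⟩, hxm, -⟩ := (hadj _ _ him.ne).1 him
  have hmi : L (e m) ≤ R (e i) := hxm.trans hxi
  refine ⟨fun hc => ?_, fun hc => ?_⟩
  · exact (hadj _ _ (e.injective.ne hij.ne')).2 ⟨hc.symm, L (e j), ⟨le_rfl, hle _⟩,
      hL hij.le, (hL hjm.le).trans hmi⟩
  · exact (hadj _ _ (e.injective.ne hjm.ne)).2 ⟨hc.symm, L (e m),
      ⟨hL hjm.le, hmi.trans (hR hij.le)⟩, le_rfl, hle _⟩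
end

section
/- Every connected finite proper interval k-graph (with at least one vertex) has a dominating pair of vertices. -/
theorem IsIntervalKRep.adj_iff {V : Type*} {G : SimpleGraph V} {k : ℕ}
    {L R : V → ℝ} {c : V → Fin k} (h : IsIntervalKRep G k L R c) {u v : V} (huv : u ≠ v) :
    G.Adj u v ↔ c u ≠ c v ∧ L u ≤ R v ∧ L v ≤ R u := by
  have hu := h.1 u
  have hv := h.1 v
  rw [h.2 u v huv, Set.Icc_inter_Icc, Set.nonempty_Icc, sup_le_iff, le_inf_iff, le_inf_iff]
  tauto

theorem ProperRep.right_le_right {V : Type*} {L R : V → ℝ} (h : ProperRep L R)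
    {u v : V} (hu : L u ≤ R u) (huv : L u ≤ L v) : R u ≤ R v := by
  by_contra! hlt
  have hne : v ≠ u := by
    rintro rfl
    exact lt_irrefl _ hlt
  refine h v u hne ⟨Set.Icc_subset_Icc huv hlt.le, fun hsub => ?_⟩
  exact absurd (hsub (Set.right_mem_Icc.2 hu)).2 hlt.not_ge

/-- In a proper representation, an edge whose ends both avoid the closed neighborhood of `w`
cannot lead from an interval starting no later than that of `w` to one starting no earlier. -/
theorem left_lt_left_of_adj {V : Type*} {G : SimpleGraph V} {k : ℕ}
    {L R : V → ℝ} {c : V → Fin k} (h : IsIntervalKRep G k L R c) (hp : ProperRep L R)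
    {w a b : V} (hab : G.Adj a b) (haw : w ≠ a) (hbw : w ≠ b)
    (ha : ¬ G.Adj w a) (hb : ¬ G.Adj w b) (hL : L a ≤ L w) : L b < L w := by
  have hR := hp.right_le_right (h.1 a) hL
  have hw := h.1 w
  have hbb := h.1 b
  rw [h.adj_iff haw] at ha
  rw [h.adj_iff hbw] at hb
  obtain ⟨hc, -, hba⟩ := (h.adj_iff hab.ne).1 hab
  by_contra! hle
  have hcwa : c w = c a := by
    by_contra hne
    exact ha ⟨hne, hle.trans hba, by linarith⟩
  exact hb ⟨hcwa ▸ hc, hle.trans hbb, hba.trans hR⟩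

/-- A walk avoiding the closed neighborhood of `w` and starting strictly to the left of `w`
stays strictly to the left of `w`. -/
theorem left_lt_left_of_walk {V : Type*} {G : SimpleGraph V} {k : ℕ}
    {L R : V → ℝ} {c : V → Fin k} (h : IsIntervalKRep G k L R c) (hp : ProperRep L R)
    {w a b : V} (p : G.Walk a b) (hw : ∀ x ∈ p.support, w ≠ x ∧ ¬ G.Adj w x)
    (hL : L a < L w) : L b < L w := by
  induction p with
  | nil => exact hL
  | cons hadj q ih =>
    simp only [SimpleGraph.Walk.support_cons, List.mem_cons, forall_eq_or_imp] at hw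
    obtain ⟨hwa, hwq⟩ := hw
    have hwb := hwq _ q.start_mem_support
    exact ih hwq (left_lt_left_of_adj h hp hadj hwa.1 hwb.1 hwa.2 hwb.2 hL.le)

/-- A walk between distinct vertices, from a leftmost interval to a rightmost one, dominates. -/
theorem walk_dominates {V : Type*} {G : SimpleGraph V} {k : ℕ}
    {L R : V → ℝ} {c : V → Fin k} (h : IsIntervalKRep G k L R c) (hp : ProperRep L R)
    {u v : V} (huv : u ≠ v) (hu : ∀ w, L u ≤ L w) (hv : ∀ w, L w ≤ L v) (p : G.Walk u v)
    (w : V) : w ∈ p.support ∨ ∃ x ∈ p.support, G.Adj w x := by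
  by_contra! hcon
  obtain ⟨hmem, hadj⟩ := hcon
  have hw : ∀ x ∈ p.support, w ≠ x ∧ ¬ G.Adj w x := fun x hx =>
    ⟨fun hwx => hmem (hwx ▸ hx), hadj x hx⟩
  cases p with
  | nil => exact huv rfl
  | cons hstep q =>
    simp only [SimpleGraph.Walk.support_cons, List.mem_cons, forall_eq_or_imp] at hw
    obtain ⟨hwu, hwq⟩ := hw
    have hwb := hwq _ q.start_mem_support
    exact (hv w).not_gt (left_lt_left_of_walk h hp q hwq
      (left_lt_left_of_adj h hp hstep hwu.1 hwb.1 hwu.2 hwb.2 (hu w)))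

/-- Every connected finite proper interval `k`-graph (with at
least one vertex) has a dominating pair of vertices: a pair of vertices joined
by a path such that every vertex of the graph lies on the path or is adjacent
to a vertex of the path. -/
theorem proper_intervalKGraph_dominating_pair {V : Type*} [Fintype V]
    [Nonempty V] (G : SimpleGraph V) (k : ℕ)
    (h : ∃ (L R : V → ℝ) (c : V → Fin k),
      IsIntervalKRep G k L R c ∧ ProperRep L R)
    (hconn : G.Connected) :
    ∃ (u v : V) (p : G.Walk u v), p.IsPath ∧
      ∀ w : V, w ∈ p.support ∨ ∃ x ∈ p.support, G.Adj w x := by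
  obtain ⟨L, R, c, h, hp⟩ := h
  obtain ⟨u, hu⟩ := Finite.exists_min L
  obtain ⟨v, hv⟩ := Finite.exists_max L
  rcases subsingleton_or_nontrivial V with hV | hV
  · exact ⟨u, u, .nil, .nil, fun w => Or.inl (by simp [Subsingleton.elim w u])⟩
  · obtain ⟨v', hne, hv'⟩ : ∃ v', u ≠ v' ∧ ∀ w, L w ≤ L v' := by
      by_cases huv : u = v
      · obtain ⟨v', hv'⟩ := exists_ne u
        exact ⟨v', hv'.symm, fun w => (hv w).trans (huv ▸ hu v')⟩
      · exact ⟨v, huv, hv⟩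
    obtain ⟨p, hpath⟩ := hconn.exists_isPath u v'
    exact ⟨u, v', p, hpath, walk_dominates h hp hne hu hv' p⟩
end

section
/- For every k ≥ 3, every class-proper interval k-graph is a cocomparability graph; that is, if a finite simple graph G admits a class-proper interval k-representation, then there is a strict partial order on the vertices of G whose incomparability graph is G. -/
/-- Two nonempty closed intervals meet iff neither lies strictly to the left of the other. -/
theorem Icc_inter_Icc_nonempty_iff_s7 {α : Type*} [LinearOrder α] {a b x y : α}
    (hab : a ≤ b) (hxy : x ≤ y) :
    (Set.Icc a b ∩ Set.Icc x y).Nonempty ↔ a ≤ y ∧ x ≤ b := by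
  rw [Set.Icc_inter_Icc, Set.nonempty_Icc, sup_le_iff, le_inf_iff, le_inf_iff]
  tauto

/-- A nonempty closed interval that is not a proper subset of another one has the same endpoints
as soon as its endpoints lie in that interval. -/
theorem eq_and_eq_of_not_Icc_ssubset {α : Type*} [PartialOrder α] {a b x y : α}
    (h : ¬ Set.Icc a b ⊂ Set.Icc x y) (hab : a ≤ b) (hxa : x ≤ a) (hby : b ≤ y) :
    a = x ∧ b = y := by
  have hsub : Set.Icc x y ⊆ Set.Icc a b := by
    by_contra hn
    exact h ⟨Set.Icc_subset_Icc hxa hby, hn⟩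
  obtain ⟨hax, hyb⟩ := (Set.Icc_subset_Icc_iff (hxa.trans (hab.trans hby))).1 hsub
  exact ⟨hax.antisymm hxa, hby.antisymm hyb⟩

/-- For every `k ≥ 3`, every finite class-proper interval
`k`-graph is a cocomparability graph: there is a strict partial order (an
irreflexive transitive relation) on the vertices whose incomparability graph
is `G`. -/
theorem classProper_intervalKGraph_cocomparability {V : Type*} [Fintype V]
    (G : SimpleGraph V) (k : ℕ) (hk : 3 ≤ k)
    (h : ∃ (L R : V → ℝ) (c : V → Fin k),
      IsIntervalKRep G k L R c ∧ ClassProperRep L R c) :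
    ∃ r : V → V → Prop, (∀ v, ¬ r v v) ∧
      (∀ a b d : V, r a b → r b d → r a d) ∧
      ∀ u v : V, u ≠ v → (G.Adj u v ↔ ¬ r u v ∧ ¬ r v u) := by
  obtain ⟨L, R, c, ⟨hLR, hadj⟩, hproper⟩ := h
  let e := Fintype.equivFin V
  have total : ∀ u v : V, u ≠ v → c u = c v →
      (L u ≤ L v ∧ R u ≤ R v) ∨ (L v ≤ L u ∧ R v ≤ R u) := by
    intro u v huv hc
    have h₁ := eq_and_eq_of_not_Icc_ssubset (hproper u v huv hc) (hLR u)
    have h₂ := eq_and_eq_of_not_Icc_ssubset (hproper v u huv.symm hc.symm) (hLR v)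
    grind
  refine ⟨fun u v => R u < L v ∨
    (c u = c v ∧ L u ≤ L v ∧ R u ≤ R v ∧ (L u = L v → R u = R v → e u < e v)), ?_, ?_, ?_⟩
  · rintro v (h | ⟨-, -, -, h⟩)
    · exact (hLR v).not_gt h
    · exact lt_irrefl _ (h rfl rfl)
  · rintro a b d (h₁ | ⟨hc₁, hL₁, hR₁, he₁⟩) (h₂ | ⟨hc₂, hL₂, hR₂, he₂⟩)
    · exact Or.inl (h₁.trans_le ((hLR b).trans h₂.le))
    · exact Or.inl (h₁.trans_le hL₂)
    · exact Or.inl (hR₁.trans_lt h₂)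
    · refine Or.inr ⟨hc₁.trans hc₂, hL₁.trans hL₂, hR₁.trans hR₂, fun hL hR => ?_⟩
      exact (he₁ (by linarith) (by linarith)).trans (he₂ (by linarith) (by linarith))
  · intro u v huv
    rw [hadj u v huv, Icc_inter_Icc_nonempty_iff_s7 (hLR u) (hLR v)]
    have he : e u < e v ∨ e v < e u := lt_or_gt_of_ne (e.injective.ne huv)
    by_cases hc : c u = c v
    · have := total u v huv hc
      grind
    · have hc' : c v ≠ c u := Ne.symm hc
      simp only [hc, hc', ne_eq, not_false_eq_true, true_and, false_and, or_false, not_lt]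
      exact and_comm
end

section
/- For every k ≥ 3, every class-proper interval k-graph is a function graph: if a finite simple graph G admits a class-proper interval k-representation, then there exist continuous functions f_v : [0,1] → ℝ, one for each vertex v, such that two distinct vertices u, v are adjacent in G if and only if f_u(x) = f_v(x) for some x ∈ [0,1]. -/
/-- The piecewise linear bump of height `1` and slope `n` centred at `i / n`. -/
noncomputable def tent (n i : ℕ) (x : ℝ) : ℝ := max 0 (1 - |n * x - i|)

theorem tent_nonneg (n i : ℕ) (x : ℝ) : 0 ≤ tent n i x := le_max_left _ _

theorem continuous_tent (n i : ℕ) : Continuous (tent n i) := by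
  unfold tent
  fun_prop

theorem tent_self {n : ℕ} (hn : n ≠ 0) (i : ℕ) : tent n i (i / n) = 1 := by
  have : (n : ℝ) * (i / n) = i := by field_simp
  simp [tent, this]

theorem tent_of_ne {n : ℕ} (hn : n ≠ 0) {i j : ℕ} (hij : i ≠ j) :
    tent n i (j / n) = 0 := by
  have h : (n : ℝ) * (j / n) = j := by field_simp
  have h1 : (1 : ℝ) ≤ |(j : ℝ) - i| := by
    have : (1 : ℤ) ≤ |(j : ℤ) - i| := Int.one_le_abs (by omega)
    exact_mod_cast this
  rw [tent, h]
  exact max_eq_left (by linarith)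

/-- The incomparability graph of a finite partial order is a function graph. -/
theorem exists_continuous_intersect_iff_incomparable (V : Type*) [Fintype V] [PartialOrder V] :
    ∃ f : V → ℝ → ℝ, (∀ v, Continuous (f v)) ∧
      ∀ u v : V, u ≠ v →
        ((∃ x ∈ Set.Icc (0 : ℝ) 1, f u x = f v x) ↔ ¬ u ≤ v ∧ ¬ v ≤ u) := by
  classical
  let n := Fintype.card V
  let e := Fintype.equivFin V
  let f : V → ℝ → ℝ := fun v x ↦ ∑ w with w ≤ v, (1 + (n + 1) * tent n (e w) x)
  have hcont (v : V) : Continuous (f v) :=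
    continuous_finsetSum _ fun w _ ↦
      continuous_const.add (continuous_const.mul (continuous_tent n (e w)))
  have hpos (w : V) (x : ℝ) : 0 < 1 + (n + 1) * tent n (e w) x := by
    have := tent_nonneg n (e w) x
    positivity
  have hmono {u v : V} (huv : u < v) (x : ℝ) : f u x < f v x := by
    refine Finset.sum_lt_sum_of_subset (i := v) ?_ ?_ ?_ (hpos v x) fun w _ _ ↦ (hpos w x).le
    · intro w hw
      simp only [Finset.mem_filter, Finset.mem_univ, true_and] at hw ⊢
      exact hw.trans huv.le
    · simp
    · simpa using huv.not_ge
  have hlt {u v : V} (hvu : ¬ v ≤ u) : f u (e v / n) < f v (e v / n) := by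
    have hn : n ≠ 0 := (Fintype.card_pos_iff.mpr ⟨v⟩).ne'
    have hu : f u (e v / n) ≤ n := by
      have h : f u (e v / n) = ∑ w with w ≤ u, (1 : ℝ) := by
        refine Finset.sum_congr rfl fun w hw ↦ ?_
        have hwv : (e w : ℕ) ≠ e v := fun h ↦ by
          obtain rfl := e.injective (Fin.ext h)
          simp_all
        rw [tent_of_ne hn hwv, mul_zero, add_zero]
      rw [h, Finset.sum_const, nsmul_one]
      exact_mod_cast Finset.card_le_univ _
    have hv : 1 + ((n : ℝ) + 1) * tent n (e v) (e v / n) ≤ f v (e v / n) :=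
      Finset.single_le_sum (f := fun w ↦ 1 + ((n : ℝ) + 1) * tent n (e w) (e v / n))
        (fun w _ ↦ (hpos w _).le) (by simp)
    rw [tent_self hn] at hv
    linarith
  have hmem (v : V) : (e v / n : ℝ) ∈ Set.Icc (0 : ℝ) 1 :=
    ⟨by positivity, div_le_one_of_le₀ (by exact_mod_cast (e v).isLt.le) (by positivity)⟩
  refine ⟨f, hcont, fun u v huv ↦ ⟨?_, ?_⟩⟩
  · rintro ⟨x, -, hx⟩
    exact ⟨fun h ↦ (hmono (h.lt_of_ne huv) x).ne hx,
      fun h ↦ (hmono (h.lt_of_ne huv.symm) x).ne hx.symm⟩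
  · rintro ⟨h₁, h₂⟩
    obtain ⟨x, hx, h⟩ := isPreconnected_Icc.intermediate_value₂ (hmem v) (hmem u)
      (hcont u).continuousOn (hcont v).continuousOn (hlt h₂).le (hlt h₁).le
    exact ⟨x, hx, h⟩

/-- In a class-proper representation, left and right endpoints of the intervals of a color class
are ordered alike. -/
theorem ClassProperRep.right_le {V : Type*} {k : ℕ} {L R : V → ℝ} {c : V → Fin k}
    (h : ClassProperRep L R c) (hLR : ∀ v, L v ≤ R v) {u v : V} (hc : c u = c v)
    (hL : L u ≤ L v) : R u ≤ R v := by
  by_contra! hR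
  refine h v u (fun huv ↦ hR.ne (congrArg R huv)) hc.symm ⟨Set.Icc_subset_Icc hL hR.le, fun hs ↦ ?_⟩
  exact hR.not_ge (hs ⟨hLR u, le_rfl⟩).2

/-- The complement of a class-proper interval `k`-graph is the comparability graph of a partial
order. -/
theorem exists_partialOrder_adj_iff_incomparable {V : Type*} [Finite V] {G : SimpleGraph V} {k : ℕ}
    {L R : V → ℝ} {c : V → Fin k} (hG : IsIntervalKRep G k L R c) (hp : ClassProperRep L R c) :
    ∃ _ : PartialOrder V, ∀ u v : V, u ≠ v → (G.Adj u v ↔ ¬ u ≤ v ∧ ¬ v ≤ u) := by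
  obtain ⟨hLR, hadj⟩ := hG
  obtain ⟨n, ⟨e⟩⟩ := Finite.exists_equiv_fin V
  have hR {u v : V} (hc : c u = c v) (hL : L u ≤ L v) : R u ≤ R v := hp.right_le hLR hc hL
  let r (u v : V) : Prop := R u < L v ∨ c u = c v ∧ (L u < L v ∨ L u = L v ∧ e u ≤ e v)
  let P : PartialOrder V :=
    { le := r
      le_refl := fun v ↦ Or.inr ⟨rfl, Or.inr ⟨rfl, le_rfl⟩⟩
      le_trans := by
        rintro u v w (h₁ | ⟨hc₁, h₁⟩) (h₂ | ⟨hc₂, h₂⟩)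
        · exact Or.inl (by linarith [hLR v])
        · exact Or.inl (by rcases h₂ with h₂ | ⟨h₂, -⟩ <;> linarith)
        · have := hR hc₁ (h₁.elim le_of_lt fun h ↦ h.1.le)
          exact Or.inl (by linarith)
        · refine Or.inr ⟨hc₁.trans hc₂, ?_⟩
          rcases h₁ with h₁ | ⟨h₁, h₁'⟩ <;> rcases h₂ with h₂ | ⟨h₂, h₂'⟩
          · exact Or.inl (h₁.trans h₂)
          · exact Or.inl (h₂ ▸ h₁)
          · exact Or.inl (h₁ ▸ h₂)
          · exact Or.inr ⟨h₁.trans h₂, h₁'.trans h₂'⟩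
      le_antisymm := by
        intro u v h₁ h₂
        have hu := hLR u
        have hv := hLR v
        rcases h₁ with h₁ | ⟨-, h₁ | ⟨h₁, h₁'⟩⟩ <;> rcases h₂ with h₂ | ⟨-, h₂ | ⟨h₂, h₂'⟩⟩ <;>
          first
          | linarith
          | exact e.injective (le_antisymm h₁' h₂') }
  refine ⟨P, fun u v huv ↦ ?_⟩
  change _ ↔ ¬ r u v ∧ ¬ r v u
  rw [hadj u v huv, Set.Icc_inter_Icc, Set.nonempty_Icc, sup_le_iff, le_inf_iff, le_inf_iff]
  constructor
  · rintro ⟨hc, ⟨-, h₁⟩, h₂, -⟩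
    exact ⟨fun h ↦ h.elim (fun h ↦ by linarith) fun h ↦ hc h.1,
      fun h ↦ h.elim (fun h ↦ by linarith) fun h ↦ hc h.1.symm⟩
  · rintro ⟨h₁, h₂⟩
    simp only [r, not_or, not_lt] at h₁ h₂
    refine ⟨fun hc ↦ ?_, ⟨hLR u, h₂.1⟩, h₁.1, hLR v⟩
    rcases lt_trichotomy (L u) (L v) with h | h | h
    · exact h₁.2 ⟨hc, Or.inl h⟩
    · rcases le_total (e u) (e v) with h' | h'
      · exact h₁.2 ⟨hc, Or.inr ⟨h, h'⟩⟩
      · exact h₂.2 ⟨hc.symm, Or.inr ⟨h.symm, h'⟩⟩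
    · exact h₂.2 ⟨hc.symm, Or.inl h⟩

/-- For every `k ≥ 3`, every finite class-proper interval
`k`-graph is a function graph: there are continuous functions
`f_v : [0,1] → ℝ`, one per vertex, such that distinct vertices `u, v` are
adjacent iff `f_u (x) = f_v (x)` for some `x ∈ [0,1]`. -/
theorem classProper_intervalKGraph_functionGraph {V : Type*} [Fintype V]
    (G : SimpleGraph V) (k : ℕ) (hk : 3 ≤ k)
    (h : ∃ (L R : V → ℝ) (c : V → Fin k),
      IsIntervalKRep G k L R c ∧ ClassProperRep L R c) :
    ∃ f : V → ℝ → ℝ,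
      (∀ v, ContinuousOn (f v) (Set.Icc 0 1)) ∧
      ∀ u v : V, u ≠ v →
        (G.Adj u v ↔ ∃ x ∈ Set.Icc (0 : ℝ) 1, f u x = f v x) := by
  obtain ⟨L, R, c, hG, hp⟩ := h
  obtain ⟨_, hadj⟩ := exists_partialOrder_adj_iff_incomparable hG hp
  obtain ⟨f, hf, hcross⟩ := exists_continuous_intersect_iff_incomparable V
  exact ⟨f, fun v ↦ (hf v).continuousOn,
    fun u v huv ↦ (hadj u v huv).trans (hcross u v huv).symm⟩
end

section
/- Every function graph is a cocomparability graph: if a finite simple graph G has an assignment of continuous functions f_v : [0,1] → ℝ to its vertices such that distinct vertices u, v are adjacent if and only if f_u(x) = f_v(x) for some x ∈ [0,1], then there is a strict partial order on the vertices of G whose incomparability graph is G. -/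
/-- Two continuous functions on a preconnected set that never agree there are strictly
ordered on the whole set. -/
theorem IsPreconnected.forall_lt_or_forall_gt_of_forall_ne {X : Type*} [TopologicalSpace X]
    {s : Set X} (hs : IsPreconnected s) {f g : X → ℝ} (hf : ContinuousOn f s)
    (hg : ContinuousOn g s) (hne : ∀ x ∈ s, f x ≠ g x) :
    (∀ x ∈ s, f x < g x) ∨ ∀ x ∈ s, g x < f x := by
  by_contra! h
  obtain ⟨⟨a, ha, hga⟩, b, hb, hfb⟩ := h
  obtain ⟨x, hx, hfg⟩ := hs.intermediate_value₂ hb ha hf hg hfb hga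
  exact hne x hx hfg

/-- **Golumbic–Rotem–Urrutia, one direction.** Every function
graph is a cocomparability graph: if a finite simple graph `G` has an
assignment of continuous functions `f_v : [0,1] → ℝ` to its vertices such that
distinct vertices `u, v` are adjacent iff `f_u (x) = f_v (x)` for some
`x ∈ [0,1]`, then there is a strict partial order on the vertices whose
incomparability graph is `G`. -/
theorem functionGraph_cocomparability {V : Type*} [Fintype V]
    (G : SimpleGraph V) (f : V → ℝ → ℝ)
    (hcont : ∀ v, ContinuousOn (f v) (Set.Icc 0 1))
    (hadj : ∀ u v : V, u ≠ v →
      (G.Adj u v ↔ ∃ x ∈ Set.Icc (0 : ℝ) 1, f u x = f v x)) :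
    ∃ r : V → V → Prop, (∀ v, ¬ r v v) ∧
      (∀ a b d : V, r a b → r b d → r a d) ∧
      ∀ u v : V, u ≠ v → (G.Adj u v ↔ ¬ r u v ∧ ¬ r v u) := by
  refine ⟨fun u v => ∀ x ∈ Set.Icc (0 : ℝ) 1, f u x < f v x, ?_, ?_, ?_⟩
  · exact fun v h => lt_irrefl _ (h 0 (by simp))
  · exact fun a b d hab hbd x hx => (hab x hx).trans (hbd x hx)
  · intro u v huv
    rw [hadj u v huv]
    constructor
    · rintro ⟨x, hx, hfx⟩
      exact ⟨fun h => (h x hx).ne hfx, fun h => (h x hx).ne' hfx⟩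
    · rintro ⟨huv', hvu'⟩
      by_contra! hne
      exact (isPreconnected_Icc.forall_lt_or_forall_gt_of_forall_ne (hcont u) (hcont v) hne).elim
        huv' hvu'
end

section
/- Let G be an n-vertex class-proper interval k-graph with a class-proper representation (L, R, c) in which all 2n interval endpoints are distinct, and label the vertices v_1, …, v_n so that R(v_i) < R(v_j) if and only if i < j. Then for each i with 1 ≤ i ≤ n, the closed neighborhood of v_i in the induced subgraph H = G − {v_1, …, v_{i−1}} induces a complete multipartite graph. -/
/-- Two distinct vertices whose intervals share a point are adjacent iff their colors differ. -/
theorem IsIntervalKRep.adj_iff_of_mem {V : Type*} {G : SimpleGraph V} {k : ℕ}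
    {L R : V → ℝ} {c : V → Fin k} (hrep : IsIntervalKRep G k L R c) {u v : V} (huv : u ≠ v)
    {x : ℝ} (hu : x ∈ Set.Icc (L u) (R u)) (hv : x ∈ Set.Icc (L v) (R v)) :
    G.Adj u v ↔ c u ≠ c v :=
  (hrep.2 u v huv).trans (and_iff_left ⟨x, hu, hv⟩)

/-- The right endpoint of `u` lies in the interval of every vertex of the closed neighborhood
of `u` whose right endpoint is not smaller. -/
theorem IsIntervalKRep.right_mem_Icc {V : Type*} {G : SimpleGraph V} {k : ℕ}
    {L R : V → ℝ} {c : V → Fin k} (hrep : IsIntervalKRep G k L R c) {u v : V}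
    (hR : R u ≤ R v) (hv : v = u ∨ G.Adj u v) : R u ∈ Set.Icc (L v) (R v) := by
  refine ⟨?_, hR⟩
  rcases hv with rfl | hadj
  · exact hrep.1 _
  · obtain ⟨-, y, hyu, hyv⟩ := (hrep.2 u v hadj.ne).mp hadj
    exact hyv.1.trans hyu.2

/-- **Proposition 4.1.** Let `G` be an `n`-vertex class-proper
interval `k`-graph with a class-proper representation `(L, R, c)` in which all
`2n` interval endpoints are distinct, and label the vertices `v_1, …, v_n` so
that `R (v_i) < R (v_j)` iff `i < j`.  Then for each `i`, the closed
neighborhood of `v_i` in the induced subgraph `H = G − {v_1, …, v_{i-1}}`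
induces a complete multipartite graph (non-adjacency is transitive on pairwise
distinct vertices of that closed neighborhood; adjacency in `H` between
vertices of `H` agrees with adjacency in `G`). -/
theorem classProper_closedNbhd_completeMultipartite {V : Type*} [Fintype V]
    (G : SimpleGraph V) (k : ℕ) (L R : V → ℝ) (c : V → Fin k)
    (hrep : IsIntervalKRep G k L R c) (hcp : ClassProperRep L R c)
    (hdistinct : Function.Injective (Sum.elim L R : V ⊕ V → ℝ))
    (e : Fin (Fintype.card V) ≃ V)
    (he : ∀ i j : Fin (Fintype.card V), R (e i) < R (e j) ↔ i < j)
    (i : Fin (Fintype.card V)) :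
    ∀ a b d : V,
      (i ≤ e.symm a ∧ (a = e i ∨ G.Adj (e i) a)) →
      (i ≤ e.symm b ∧ (b = e i ∨ G.Adj (e i) b)) →
      (i ≤ e.symm d ∧ (d = e i ∨ G.Adj (e i) d)) →
      a ≠ b → b ≠ d → a ≠ d →
      ¬ G.Adj a b → ¬ G.Adj b d → ¬ G.Adj a d := by
  have hmem : ∀ v : V, (i ≤ e.symm v ∧ (v = e i ∨ G.Adj (e i) v)) →
      R (e i) ∈ Set.Icc (L v) (R v) := fun v ⟨hle, hv⟩ =>
    hrep.right_mem_Icc (not_lt.mp fun hlt => hle.not_gt ((he _ _).mp (by simpa using hlt))) hv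
  intro a b d ha hb hd hab hbd had
  rw [hrep.adj_iff_of_mem hab (hmem a ha) (hmem b hb),
    hrep.adj_iff_of_mem hbd (hmem b hb) (hmem d hd),
    hrep.adj_iff_of_mem had (hmem a ha) (hmem d hd), not_not, not_not, not_not]
  exact Eq.trans
end

section
/- Let G be an n-vertex class-proper interval k-graph with a class-proper representation in which all interval endpoints are distinct, with vertices labeled v_1, …, v_n so that R(v_i) < R(v_j) if and only if i < j, and let ≺ be a strict partial order on the vertices whose incomparability graph is G and which satisfies: v_i ≺ v_j implies i < j. Then for each i, the element v_i is minimal in the restriction P' of ≺ to {v_i, v_{i+1}, …, v_n}, and the set of elements of {v_{i+1}, …, v_n} incomparable with v_i can be decomposed into chains of P'. -/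
/-- A set `S` decomposes into chains of the strict order `r`: `S` can be
partitioned into sets `C_1, …, C_m` each totally ordered by `r`, with every
element of `C_t` incomparable to every element of `C_{t'}` for `t ≠ t'`. -/
def DecomposesIntoChains {V : Type*} (r : V → V → Prop) (S : Set V) : Prop :=
  ∃ (m : ℕ) (C : Fin m → Set V),
    (∀ t, C t ⊆ S) ∧
    (∀ x ∈ S, ∃! t, x ∈ C t) ∧
    (∀ t, IsChain r (C t)) ∧
    (∀ t t', t ≠ t' → ∀ a ∈ C t, ∀ b ∈ C t', ¬ r a b ∧ ¬ r b a)

/-- **Corollary 4.1.** Let `G` be an `n`-vertex class-proper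
interval `k`-graph with a class-proper representation in which all interval
endpoints are distinct, with vertices labeled `v_1, …, v_n` so that
`R (v_i) < R (v_j)` iff `i < j`, and let `r` be a strict partial order whose
incomparability graph is `G` and which satisfies `v_i ≺ v_j → i < j`.  Then for
each `i`, the element `v_i` is minimal in the restriction of `r` to
`{v_i, …, v_n}`, and the set of elements of `{v_{i+1}, …, v_n}` incomparable
with `v_i` decomposes into chains of that restriction. -/
theorem classProper_order_elimination {V : Type*} [Fintype V]
    (G : SimpleGraph V) (k : ℕ) (L R : V → ℝ) (c : V → Fin k)
    (hrep : IsIntervalKRep G k L R c) (hcp : ClassProperRep L R c)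
    (hdistinct : Function.Injective (Sum.elim L R : V ⊕ V → ℝ))
    (e : Fin (Fintype.card V) ≃ V)
    (he : ∀ i j : Fin (Fintype.card V), R (e i) < R (e j) ↔ i < j)
    (r : V → V → Prop) (hirr : ∀ v, ¬ r v v)
    (htrans : ∀ a b d : V, r a b → r b d → r a d)
    (hincomp : ∀ u v : V, u ≠ v → (G.Adj u v ↔ ¬ r u v ∧ ¬ r v u))
    (hord : ∀ i j : Fin (Fintype.card V), r (e i) (e j) → i < j)
    (i : Fin (Fintype.card V)) :
    (∀ j : Fin (Fintype.card V), i ≤ j → ¬ r (e j) (e i)) ∧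
    DecomposesIntoChains r
      {x : V | i < e.symm x ∧ ¬ r (e i) x ∧ ¬ r x (e i)} := by
  refine ⟨fun j hij hji => absurd (hord j i hji) (not_lt.mpr hij), ?_⟩
  set S : Set V := {x : V | i < e.symm x ∧ ¬ r (e i) x ∧ ¬ r x (e i)}
  -- All intervals of elements of `S` contain the right endpoint of `e i`.
  have hmem : ∀ x ∈ S, R (e i) ∈ Set.Icc (L x) (R x) := by
    rintro x ⟨hlt, h₁, h₂⟩
    have hne : e i ≠ x := by
      rintro rfl
      simp at hlt
    have hR : R (e i) < R x := by simpa using (he i (e.symm x)).mpr hlt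
    obtain ⟨y, hy, hyx⟩ :=
      ((hrep.2 _ _ hne).mp ((hincomp _ _ hne).mpr ⟨h₁, h₂⟩)).2
    exact ⟨hyx.1.trans hy.2, hR.le⟩
  refine ⟨k, fun t => {x | x ∈ S ∧ c x = t}, fun t x hx => hx.1,
    fun x hx => ⟨c x, ⟨hx, rfl⟩, fun t ht => ht.2.symm⟩, ?_, ?_⟩
  · rintro t a ⟨-, ha⟩ b ⟨-, hb⟩ hab
    have hnadj : ¬ G.Adj a b := fun h =>
      ((hrep.2 a b hab).mp h).1 (ha.trans hb.symm)
    rw [hincomp a b hab] at hnadj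
    tauto
  · rintro t t' htt' a ⟨haS, ha⟩ b ⟨hbS, hb⟩
    have hc : c a ≠ c b := by rwa [ha, hb]
    have hab : a ≠ b := fun h => hc (congrArg c h)
    exact (hincomp a b hab).mp
      ((hrep.2 a b hab).mpr ⟨hc, R (e i), hmem a haS, hmem b hbS⟩)
end

section
/- Let P = (V, ≺) be a finite strict partial order of width k whose elements are labeled v_1, …, v_n so that, for each i, the element v_i is minimal in the restriction P' of ≺ to {v_i, v_{i+1}, …, v_n} and the set N̄_{P'}(v_i) of elements of {v_{i+1}, …, v_n} incomparable with v_i can be decomposed into chains of P'. Then V can be partitioned into k chains (called classes) such that, for every i, any two comparable elements of N̄_{P'}(v_i) belong to the same class; equivalently, each chain in the chain decomposition of N̄_{P'}(v_i) is contained in a single class. -/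
/-- Intervals `[s d, t d]` of natural numbers such that every point lies in at most `k` of them
can be coloured with `k` colours so that intervals of the same colour are disjoint. -/
theorem exists_interval_coloring {V : Type*} (s t : V → ℕ) (k : ℕ) (R : Finset V)
    (hst : ∀ d ∈ R, s d ≤ t d)
    (hk : ∀ p : ℕ, ∀ T ⊆ R, (∀ d ∈ T, s d ≤ p ∧ p ≤ t d) → T.card ≤ k) :
    ∃ c : V → ℕ, (∀ d ∈ R, c d < k) ∧
      ∀ d ∈ R, ∀ d' ∈ R, d ≠ d' → c d = c d' → t d < s d' ∨ t d' < s d := by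
  classical
  induction R using Finset.induction_on_max_value s with
  | empty => exact ⟨fun _ => 0, by simp, by simp⟩
  | insert a R ha hmax ih =>
    obtain ⟨c, hc, hdisj⟩ := ih (fun d hd => hst d (Finset.mem_insert_of_mem hd))
      (fun p T hT => hk p T (hT.trans (Finset.subset_insert a R)))
    let B := R.filter fun d => s a ≤ t d
    have hB : B ⊆ R := Finset.filter_subset _ _
    have haB : a ∉ B := fun h => ha (hB h)
    have hcard : B.card < k := by
      have h := hk (s a) (insert a B) (Finset.insert_subset_insert a hB) (by
        intro d hd
        rcases Finset.mem_insert.1 hd with rfl | hd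
        · exact ⟨le_rfl, hst _ (Finset.mem_insert_self _ _)⟩
        · exact ⟨hmax d (hB hd), (Finset.mem_filter.1 hd).2⟩)
      rw [Finset.card_insert_of_notMem haB] at h
      omega
    obtain ⟨q, hq, hqB⟩ : ∃ q ∈ Finset.range k, q ∉ B.image c := by
      apply Finset.exists_mem_notMem_of_card_lt_card
      rw [Finset.card_range]
      exact Finset.card_image_le.trans_lt hcard
    have hne : ∀ d ∈ R, d ≠ a := fun d hd h => ha (h ▸ hd)
    have hfree : ∀ d ∈ R, c d = q → t d < s a := by
      intro d hd hcd
      by_contra hlt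
      exact hqB (Finset.mem_image.2 ⟨d, Finset.mem_filter.2 ⟨hd, not_lt.1 hlt⟩, hcd⟩)
    refine ⟨Function.update c a q, ?_, ?_⟩
    · intro d hd
      rcases Finset.mem_insert.1 hd with rfl | hd
      · simpa using hq
      · simpa [hne d hd] using hc d hd
    · intro d hd d' hd' hdd' hcol
      rcases Finset.mem_insert.1 hd with h | h <;> rcases Finset.mem_insert.1 hd' with h' | h'
      · exact absurd (h.trans h'.symm) hdd'
      · rw [h, Function.update_self, Function.update_of_ne (hne d' h')] at hcol
        exact Or.inr (h ▸ hfree d' h' hcol.symm)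
      · rw [h', Function.update_self, Function.update_of_ne (hne d h)] at hcol
        exact Or.inl (h' ▸ hfree d h hcol)
      · rw [Function.update_of_ne (hne d' h'), Function.update_of_ne (hne d h)] at hcol
        exact hdisj d h d' h' hdd' hcol

/-- A map that decreases a natural number at every point it moves has an iterate that is a
retraction onto its fixed points. -/
theorem exists_retraction_of_decreasing {V : Type*} [Finite V] (idx : V → ℕ) (p : V → V)
    (hp : ∀ b, p b = b ∨ idx (p b) < idx b) :
    ∃ ρ : V → V, (∀ b, ρ (p b) = ρ b) ∧ (∀ b, p b = b → ρ b = b) ∧ ∀ b, p (ρ b) = ρ b := by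
  have hfix : ∀ n b, idx b ≤ n → p (p^[n] b) = p^[n] b := by
    intro n
    induction n with
    | zero =>
      intro b hb
      rcases hp b with h | h
      · exact h
      · omega
    | succ n ih =>
      intro b hb
      rw [Function.iterate_succ_apply]
      rcases hp b with h | h
      · rw [h, Function.iterate_fixed h n, h]
      · exact ih (p b) (by omega)
  obtain ⟨N, hN⟩ := (Set.finite_range idx).bddAbove
  have hN' : ∀ b, idx b ≤ N := fun b => hN ⟨b, rfl⟩
  refine ⟨p^[N], fun b => ?_, fun b h => Function.iterate_fixed h N, fun b => hfix N b (hN' b)⟩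
  rw [← Function.iterate_succ_apply, Function.iterate_succ_apply']
  exact hfix N b (hN' b)

/-- In a set that decomposes into chains, comparability is transitive. -/
theorem DecomposesIntoChains.comparable_trans {V : Type*} {r : V → V → Prop} {S : Set V}
    (hS : DecomposesIntoChains r S) {a b c : V} (ha : a ∈ S) (hb : b ∈ S) (hc : c ∈ S)
    (hab : r a b ∨ r b a) (hbc : r b c ∨ r c b) : a = c ∨ r a c ∨ r c a := by
  obtain ⟨m, C, -, hcov, hchain, hsep⟩ := hS
  have hsame : ∀ {x y : V} {t t' : Fin m}, x ∈ C t → y ∈ C t' → (r x y ∨ r y x) → t = t' := by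
    intro x y t t' hx hy hxy
    by_contra hne
    have := hsep t t' hne x hx y hy
    tauto
  obtain ⟨ta, hta, -⟩ := hcov a ha
  obtain ⟨tb, htb, -⟩ := hcov b hb
  obtain ⟨tc, htc, -⟩ := hcov c hc
  obtain rfl := hsame hta htb hab
  obtain rfl := hsame htb htc hbc
  by_cases hac : a = c
  · exact Or.inl hac
  · exact Or.inr (hchain ta hta htc hac)

section Linked

variable {V : Type*} (r : V → V → Prop) (idx : V → ℕ)

/-- The least label of an element that is not below `b`. -/
noncomputable def gap (b : V) : ℕ := sInf {t | ∃ v, idx v = t ∧ ¬ r v b}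

/-- `a` is below `b`, and some element with a smaller label than `a` is not below `b`. -/
def Linked (a b : V) : Prop := r a b ∧ gap r idx b < idx a

variable {r idx}

theorem gap_le {v b : V} (h : ¬ r v b) : gap r idx b ≤ idx v :=
  Nat.sInf_le ⟨v, rfl, h⟩

theorem rel_of_lt_gap {v b : V} (h : idx v < gap r idx b) : r v b := by
  by_contra hv
  exact absurd (gap_le hv) (not_le.2 h)

theorem exists_idx_eq_gap (hirr : ∀ v, ¬ r v v) (b : V) : ∃ v, idx v = gap r idx b ∧ ¬ r v b :=
  Nat.sInf_mem (s := {t | ∃ v, idx v = t ∧ ¬ r v b}) ⟨idx b, b, rfl, hirr b⟩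

variable (hirr : ∀ v, ¬ r v v) (htrans : ∀ a b d : V, r a b → r b d → r a d)
  (hidx : Function.Injective idx) (hlt : ∀ a b, r a b → idx a < idx b)
  (hcomp : ∀ v a b c, idx v < idx a → idx v < idx b → idx v < idx c →
    ¬ r v a → ¬ r v b → ¬ r v c → (r a b ∨ r b a) → (r b c ∨ r c b) → a = c ∨ r a c ∨ r c a)

include hirr htrans hlt hcomp

theorem Linked.of_common_right {a a' b : V} (ha : Linked r idx a b) (ha' : Linked r idx a' b)
    (h : idx a < idx a') : Linked r idx a a' := by
  obtain ⟨w, hw, hwb⟩ := exists_idx_eq_gap (idx := idx) hirr b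
  have hab := hlt _ _ ha.1
  have h1 := ha.2
  have hwa : ¬ r w a := fun h' => hwb (htrans _ _ _ h' ha.1)
  have hwa' : ¬ r w a' := fun h' => hwb (htrans _ _ _ h' ha'.1)
  rcases hcomp w a b a' (by omega) (by omega) (by omega) hwa hwb hwa'
    (Or.inl ha.1) (Or.inr ha'.1) with h' | h' | h'
  · subst h'
    omega
  · exact ⟨h', (gap_le hwa').trans_lt (by omega)⟩
  · have := hlt _ _ h'
    omega

include hidx

theorem Linked.of_common_left {a b c : V} (hb : Linked r idx a b) (hc : Linked r idx a c)
    (h : b ≠ c) : Linked r idx b c ∨ Linked r idx c b := by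
  have key : ∀ v, idx v < idx a → ¬ r v b → ¬ r v c → Linked r idx b c ∨ Linked r idx c b := by
    intro v hva hvb hvc
    have hab := hlt _ _ hb.1
    have hac := hlt _ _ hc.1
    have hnva : ¬ r v a := fun h' => hvb (htrans _ _ _ h' hb.1)
    rcases hcomp v b a c (by omega) (by omega) (by omega) hvb hnva hvc
      (Or.inr hb.1) (Or.inl hc.1) with h' | h' | h'
    · exact absurd h' h
    · exact Or.inl ⟨h', (gap_le hvc).trans_lt (by omega)⟩
    · exact Or.inr ⟨h', (gap_le hvb).trans_lt (by omega)⟩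
  have crossed : ∀ (b c v w : V), Linked r idx a b → Linked r idx a c → idx v < idx w →
      idx w < idx a → ¬ r v b → ¬ r w c → r w b → False := by
    intro b c v w hb hc hvw hwa hvb hwc hwb
    have hab := hlt _ _ hb.1
    have hnva : ¬ r v a := fun h' => hvb (htrans _ _ _ h' hb.1)
    have hnvw : ¬ r v w := fun h' => hvb (htrans _ _ _ h' hwb)
    rcases hcomp v a b w (by omega) (by omega) hvw hnva hvb hnvw
      (Or.inl hb.1) (Or.inr hwb) with h' | h' | h'
    · subst h'
      omega
    · have := hlt _ _ h'
      omega
    · exact hwc (htrans _ _ _ h' hc.1)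
  obtain ⟨v, hv, hvb⟩ := exists_idx_eq_gap (idx := idx) hirr b
  obtain ⟨w, hw, hwc⟩ := exists_idx_eq_gap (idx := idx) hirr c
  have hva : idx v < idx a := hv ▸ hb.2
  have hwa : idx w < idx a := hw ▸ hc.2
  by_cases hvc : r v c
  · by_cases hwb : r w b
    · have hne : idx v ≠ idx w := fun h' => hvb (hidx h' ▸ hwb)
      rcases lt_or_gt_of_ne hne with h' | h'
      · exact (crossed b c v w hb hc h' hwa hvb hwc hwb).elim
      · exact (crossed c b w v hc hb h' hva hwc hvb hvc).elim
    · exact key w hwa hwb hwc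
  · exact key v hva hvb hvc

/-- Every element that is linked to a smaller one has a largest element linked to it, which is
linked to all the others; `p` picks it, and fixes all other elements. -/
theorem exists_linked_pred [Finite V] : ∃ p : V → V, ∀ b,
    (p b = b ∧ ∀ a, ¬ Linked r idx a b) ∨
      (Linked r idx (p b) b ∧ ∀ a, Linked r idx a b → a = p b ∨ Linked r idx a (p b)) := by
  suffices h : ∀ b, ∃ q, (q = b ∧ ∀ a, ¬ Linked r idx a b) ∨
      (Linked r idx q b ∧ ∀ a, Linked r idx a b → a = q ∨ Linked r idx a q) by
    choose p hp using h
    exact ⟨p, hp⟩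
  intro b
  by_cases hL : ∃ a, Linked r idx a b
  · obtain ⟨q, hq, hmax⟩ :=
      Set.exists_max_image {a | Linked r idx a b} idx (Set.toFinite _) hL
    refine ⟨q, Or.inr ⟨hq, fun a ha => ?_⟩⟩
    rcases (hmax a ha).lt_or_eq with h | h
    · exact Or.inr (Linked.of_common_right hirr htrans hlt hcomp ha hq h)
    · exact Or.inl (hidx h)
  · exact ⟨b, Or.inl ⟨rfl, not_exists.1 hL⟩⟩

/-- The classes generated by `Linked` are chains: there is a map `ρ` sending each element to the
least element of its class. -/
theorem exists_linked_root [Finite V] : ∃ ρ : V → V,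
    (∀ a b, Linked r idx a b → ρ a = ρ b) ∧
    (∀ b, ρ (ρ b) = ρ b) ∧
    (∀ b, ρ b = b ∨ ∃ a, Linked r idx a b) ∧
    (∀ b, ρ b = b ∨ r (ρ b) b) ∧
    ∀ a b, ρ a = ρ b → idx a < idx b → r a b := by
  obtain ⟨p, hp⟩ := exists_linked_pred hirr htrans hidx hlt hcomp
  obtain ⟨ρ, hρp, hρfix, hpρ⟩ := exists_retraction_of_decreasing idx p fun b =>
    (hp b).imp And.left fun h => hlt _ _ h.1.1
  have hlink : ∀ n b, idx b = n → ∀ a, Linked r idx a b → ρ a = ρ b := by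
    intro n
    induction n using Nat.strong_induction_on with
    | _ n ih =>
      rintro b rfl a ha
      rcases hp b with ⟨-, h⟩ | ⟨hpb, h⟩
      · exact absurd ha (h a)
      · rcases h a ha with rfl | h'
        · exact hρp b
        · exact (ih _ (hlt _ _ hpb.1) (p b) rfl a h').trans (hρp b)
  have hle : ∀ n b, idx b = n → ρ b = b ∨ r (ρ b) b := by
    intro n
    induction n using Nat.strong_induction_on with
    | _ n ih =>
      rintro b rfl
      rcases hp b with ⟨h, -⟩ | ⟨hpb, -⟩
      · exact Or.inl (hρfix b h)
      · right
        have h := ih _ (hlt _ _ hpb.1) (p b) rfl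
        rw [hρp] at h
        rcases h with h | h
        · rw [h]
          exact hpb.1
        · exact htrans _ _ _ h hpb.1
  have hidxle : ∀ b, idx (ρ b) ≤ idx b := fun b => by
    rcases hle _ b rfl with h | h
    · rw [h]
    · exact (hlt _ _ h).le
  have hpred : ∀ {x}, idx (ρ x) < idx x → Linked r idx (p x) x := by
    intro x hx
    rcases hp x with ⟨h, -⟩ | ⟨h, -⟩
    · rw [hρfix x h] at hx
      omega
    · exact h
  have hchain : ∀ n y, idx y = n → ∀ x, ρ x = ρ y → idx x < idx y → x = p y ∨ r x (p y) := by
    intro n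
    induction n using Nat.strong_induction_on with
    | _ n ih =>
      rintro y rfl
      have hbetween : ∀ m x, idx x = m → ρ x = ρ y → idx (p y) < idx x → idx x < idx y →
          False := by
        intro m
        induction m using Nat.strong_induction_on with
        | _ m ihm =>
          rintro x rfl hxy hpx hx
          have hroot : idx (ρ y) ≤ idx (p y) := hρp y ▸ hidxle (p y)
          have hLx : Linked r idx (p x) x := hpred (by rw [hxy]; omega)
          have hLy : Linked r idx (p y) y := hpred (by omega)
          rcases ih _ hx x rfl (p y) (by rw [hρp, hxy]) hpx with h | h
          · have hne : x ≠ y := by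
              rintro rfl
              omega
            rcases Linked.of_common_left hirr htrans hidx hlt hcomp (h ▸ hLx) hLy hne with h' | h'
            · rcases hp y with ⟨-, h0⟩ | ⟨-, h0⟩
              · exact h0 _ h'
              · rcases h0 x h' with h1 | h1
                · rw [← h1] at hpx
                  omega
                · have := hlt _ _ h1.1
                  omega
            · have := hlt _ _ h'.1
              omega
          · exact ihm _ (hlt _ _ hLx.1) (p x) rfl (by rw [hρp, hxy]) (hlt _ _ h)
              ((hlt _ _ hLx.1).trans hx)
      intro x hxy hx
      have hroot : idx (ρ y) ≤ idx x := hxy ▸ hidxle x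
      have hLy : Linked r idx (p y) y := hpred (by omega)
      rcases lt_trichotomy (idx x) (idx (p y)) with h | h | h
      · have hy := hlt _ _ hLy.1
        have hxp : ρ x = ρ (p y) := by rw [hρp, hxy]
        have hroot' : idx (ρ (p y)) ≤ idx x := hxp ▸ hidxle x
        have hLp := (hpred (x := p y) (by omega)).1
        rcases ih _ hy (p y) rfl x hxp h with h' | h'
        · rw [h']
          exact Or.inr hLp
        · exact Or.inr (htrans _ _ _ h' hLp)
      · exact Or.inl (hidx h)
      · exact (hbetween _ x rfl hxy h hx).elim
  refine ⟨ρ, fun a b => hlink _ b rfl a, fun b => hρfix _ (hpρ b), fun b => ?_,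
    fun b => hle _ b rfl, fun a b hab h => ?_⟩
  · rcases hp b with ⟨h, -⟩ | ⟨h, -⟩
    · exact Or.inl (hρfix b h)
    · exact Or.inr ⟨_, h⟩
  · have hLb : (r (p b) b) :=
      (hpred (lt_of_le_of_lt (hab ▸ hidxle a) h)).1
    rcases hchain _ b rfl a hab h with h' | h'
    · rw [h']
      exact hLb
    · exact htrans _ _ _ h' hLb

/-- A finite strict order, labelled along a linear extension, in which later elements incomparable
to a given one form disjoint chains, has a cover by as many chains as its largest antichain,
with linked elements in the same chain. -/
theorem exists_chain_cover_of_linked [Finite V] (k : ℕ)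
    (hk : ∀ A : Finset V, IsAntichain r (A : Set V) → A.card ≤ k) :
    ∃ f : V → Fin k, (∀ a b, f a = f b → a ≠ b → r a b ∨ r b a) ∧
      ∀ a b, Linked r idx a b → f a = f b := by
  classical
  have := Fintype.ofFinite V
  obtain ⟨ρ, hlink, hρρ, hpred, hle, hchain⟩ := exists_linked_root hirr htrans hidx hlt hcomp
  have hlast : ∀ d, ∃ x, ρ x = ρ d ∧ ∀ y, ρ y = ρ d → idx y ≤ idx x := by
    intro d
    obtain ⟨x, hx, hmax⟩ :=
      Set.exists_max_image {x | ρ x = ρ d} idx (Set.toFinite _) ⟨d, rfl⟩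
    exact ⟨x, hx, hmax⟩
  choose last hρlast hlast using hlast
  have hfirst : ∀ (t : ℕ) (d : V), ∃ x, t ≤ idx (last d) → ρ x = ρ d ∧ t ≤ idx x ∧
      ∀ y, ρ y = ρ d → t ≤ idx y → idx x ≤ idx y := by
    intro t d
    by_cases ht : t ≤ idx (last d)
    · obtain ⟨x, hx, hmin⟩ := Set.exists_min_image {x | ρ x = ρ d ∧ t ≤ idx x} idx
        (Set.toFinite _) ⟨last d, hρlast d, ht⟩
      exact ⟨x, fun _ => ⟨hx.1, hx.2, fun y h1 h2 => hmin y ⟨h1, h2⟩⟩⟩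
    · exact ⟨d, fun h => absurd h ht⟩
  choose first hfirst using hfirst
  let R : Finset V := Finset.univ.filter fun d => ρ d = d
  have hR : ∀ {d}, d ∈ R ↔ ρ d = d := by simp [R]
  obtain ⟨c, hc, hdisj⟩ := exists_interval_coloring (gap r idx) (fun d => idx (last d)) k R
    (fun d _ => (gap_le (hirr d)).trans (hlast d d rfl)) (by
      intro t T hT hTt
      have hρfirst : ∀ d ∈ T, ρ (first t d) = d := fun d hd => by
        rw [(hfirst t d (hTt d hd).2).1, hR.1 (hT hd)]
      have hinj : Set.InjOn (first t) T := fun d hd d' hd' h => by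
        rw [← hρfirst d hd, ← hρfirst d' hd', h]
      rw [← Finset.card_image_of_injOn hinj]
      apply hk
      intro x hx y hy hxy hr
      obtain ⟨d, hd, rfl⟩ := Finset.mem_image.1 hx
      obtain ⟨d', hd', rfl⟩ := Finset.mem_image.1 hy
      have hdd' : d ≠ d' := fun h => hxy (h ▸ rfl)
      obtain ⟨-, htx, -⟩ := hfirst t d (hTt d hd).2
      obtain ⟨hρy, -, hminy⟩ := hfirst t d' (hTt d' hd').2
      have hgap : idx (first t d) ≤ gap r idx (first t d') := by
        by_contra h
        have := hlink _ _ ⟨hr, not_le.1 h⟩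
        rw [hρfirst d hd, hρfirst d' hd'] at this
        exact hdd' this
      have hgap_ne : idx (first t d) ≠ gap r idx (first t d') := by
        intro h
        obtain ⟨v, hv, hvy⟩ := exists_idx_eq_gap (idx := idx) hirr (first t d')
        exact hvy (hidx (hv.trans h.symm) ▸ hr)
      rcases hpred (first t d') with h | ⟨a, ha⟩
      · rw [hρfirst d' hd'] at h
        have := (hTt d' hd').1
        rw [← h] at hgap hgap_ne
        omega
      · have h1 := ha.2
        have h2 := hlt _ _ ha.1
        have h3 := hminy a ((hlink _ _ ha).trans hρy) (by omega)
        omega)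
  have hρR : ∀ x, ρ x ∈ R := fun x => hR.2 (hρρ x)
  have hsep : ∀ a b, idx (last (ρ a)) < gap r idx (ρ b) → r a b := by
    intro a b h
    have ha : r a (ρ b) := rel_of_lt_gap ((hlast (ρ a) a (hρρ a).symm).trans_lt h)
    rcases hle b with h' | h'
    · rwa [h'] at ha
    · exact htrans _ _ _ ha h'
  refine ⟨fun x => ⟨c (ρ x), hc _ (hρR x)⟩, fun a b hab hne => ?_, fun a b h => ?_⟩
  · have hab' : c (ρ a) = c (ρ b) := by simpa using hab
    by_cases hroot : ρ a = ρ b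
    · rcases lt_or_gt_of_ne (hidx.ne hne) with h | h
      · exact Or.inl (hchain a b hroot h)
      · exact Or.inr (hchain b a hroot.symm h)
    · exact (hdisj _ (hρR a) _ (hρR b) hroot hab').imp (hsep a b) (hsep b a)
  · simp [hlink a b h]

end Linked

/-- **the Claim in the proof of Theorem 4.2.** Let
`P = (V, ≺)` be a finite strict partial order of width `k` whose elements are
labeled `v_1, …, v_n` so that, for each `i`, `v_i` is minimal in the
restriction of `≺` to `{v_i, …, v_n}` and the set `N̄(v_i)` of elements of
`{v_{i+1}, …, v_n}` incomparable with `v_i` decomposes into chains.  Then `V`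
can be partitioned into `k` (nonempty) chains — the classes — such that for
every `i`, any two comparable elements of `N̄(v_i)` belong to the same class. -/
theorem chain_cover_respecting_neighborhood_chains {V : Type*} [Fintype V]
    (r : V → V → Prop) (hirr : ∀ v, ¬ r v v)
    (htrans : ∀ a b d : V, r a b → r b d → r a d)
    (e : Fin (Fintype.card V) ≃ V)
    (hmin : ∀ i j : Fin (Fintype.card V), i ≤ j → ¬ r (e j) (e i))
    (hdec : ∀ i : Fin (Fintype.card V),
      DecomposesIntoChains r
        {x : V | i < e.symm x ∧ ¬ r (e i) x ∧ ¬ r x (e i)})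
    (k : ℕ)
    (hwidth : (∃ A : Finset V, IsAntichain r ↑A ∧ A.card = k) ∧
      ∀ A : Finset V, IsAntichain r ↑A → A.card ≤ k) :
    ∃ f : V → Fin k,
      (∀ t : Fin k, IsChain r (f ⁻¹' {t})) ∧
      (∀ t : Fin k, (f ⁻¹' {t}).Nonempty) ∧
      ∀ i : Fin (Fintype.card V), ∀ a b : V,
        a ∈ {x : V | i < e.symm x ∧ ¬ r (e i) x ∧ ¬ r x (e i)} →
        b ∈ {x : V | i < e.symm x ∧ ¬ r (e i) x ∧ ¬ r x (e i)} →
        (r a b ∨ r b a) → f a = f b := by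
  classical
  let idx : V → ℕ := fun x => (e.symm x : ℕ)
  have hidx : Function.Injective idx := Fin.val_injective.comp e.symm.injective
  have hlt : ∀ a b, r a b → idx a < idx b := by
    intro a b hab
    by_contra h
    exact hmin (e.symm b) (e.symm a) (not_lt.1 h) (by simpa using hab)
  have hmem : ∀ v x, idx v < idx x → ¬ r v x →
      x ∈ {x : V | e.symm v < e.symm x ∧ ¬ r (e (e.symm v)) x ∧ ¬ r x (e (e.symm v))} := by
    intro v x hvx hr
    refine ⟨hvx, by simpa using hr, fun h => ?_⟩
    have := hlt _ _ h
    rw [e.apply_symm_apply] at this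
    omega
  obtain ⟨f, hf, hlink⟩ := exists_chain_cover_of_linked hirr htrans hidx hlt
    (fun v a b c ha hb hc hva hvb hvc => (hdec (e.symm v)).comparable_trans
      (hmem v a ha hva) (hmem v b hb hvb) (hmem v c hc hvc)) k hwidth.2
  have hlinked : ∀ i a b, i < e.symm a → ¬ r (e i) b → r a b → f a = f b := by
    intro i a b hia hib hab
    refine hlink a b ⟨hab, (gap_le hib).trans_lt ?_⟩
    simpa [idx] using hia
  refine ⟨f, ?_, ?_, ?_⟩
  · rintro t a rfl b hb hne
    exact hf a b (Eq.symm hb) hne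
  · obtain ⟨⟨A, hA, hcard⟩, -⟩ := hwidth
    have hinj : Set.InjOn f A := by
      intro a ha b hb hab
      by_contra hne
      exact (hf a b hab hne).elim (hA ha hb hne) (hA hb ha (Ne.symm hne))
    have himage : A.image f = Finset.univ := by
      rw [← Finset.card_eq_iff_eq_univ, Finset.card_image_of_injOn hinj, hcard, Fintype.card_fin]
    intro t
    obtain ⟨a, -, ha⟩ := Finset.mem_image.1 (himage ▸ Finset.mem_univ t)
    exact ⟨a, ha⟩
  · rintro i a b ⟨hia, hra, -⟩ ⟨hib, hrb, -⟩ (hab | hba)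
    · exact hlinked i a b hia hrb hab
    · exact (hlinked i b a hib hra hba).symm
end
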